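/- Let X be a completely regular topological space, let μ be a non-atomic Radon probability measure on X concentrated on a countable union of metrizable compact sets, let Y be a complete metric space, let T be a metric space, and suppose the mapping t ↦ ν_t from T to P_r(Y) is continuous in the weak topology. Let h : X × Y × T → [0,∞) be a continuous function such that h(x,y,t) ≤ a_t(x) + b_t(y), where a_t ∈ L¹(μ), b_t ∈ L¹(ν_t) are nonnegative Borel functions with lim_{R→+∞} sup_{t∈T} ( ∫_{{a_t ≥ R}} a_t dμ + ∫_{{b_t ≥ R}} b_t dν_t ) = 0. Then for every ε > 0 one can select ε-optimal Monge mappings T_t^ε : X → Y for the cost functions h_t = h(·,·,t) and marginals (μ, ν_t) with μ∘(T_t^ε)⁻¹ = ν_t for every t, such that the family (T_t^ε) is continuous in t in the sense of convergence μ-a.e. -/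

import Mathlib

open MeasureTheory Filter Topology

noncomputable section

/-- `σ` is a coupling of `μ` and `ν`, i.e. an element of `Π(μ, ν)`: a measure on the
product whose projections onto the factors are `μ` and `ν`. -/
def IsCoupling {X Y : Type*} [MeasurableSpace X] [MeasurableSpace Y]
    (σ : Measure (X × Y)) (μ : Measure X) (ν : Measure Y) : Prop :=
  σ.map Prod.fst = μ ∧ σ.map Prod.snd = ν

/-- The Kantorovich optimal transportation cost
`K_h(μ, ν) = inf {∫ h dσ : σ ∈ Π(μ, ν)}` (for a nonnegative cost `h`). -/
def kantorovichCost {X Y : Type*} [MeasurableSpace X] [MeasurableSpace Y]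
    (h : X → Y → ℝ) (μ : Measure X) (ν : Measure Y) : ENNReal :=
  ⨅ (σ : Measure (X × Y)) (_ : IsCoupling σ μ ν), ∫⁻ p, ENNReal.ofReal (h p.1 p.2) ∂σ

/-- A family of measures `t ↦ μ t` is continuous in the weak topology generated by
integration against bounded continuous functions. -/
def WeaklyContinuousFamily {T X : Type*} [TopologicalSpace T] [TopologicalSpace X]
    [MeasurableSpace X] (μ : T → Measure X) : Prop :=
  ∀ f : BoundedContinuousFunction X ℝ, Continuous fun t => ∫ x, f x ∂(μ t)


namespace AM

/-- Lebesgue measure on the unit interval. -/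
def lam : Measure ℝ := volume.restrict (Set.Ioo 0 1)

instance : IsProbabilityMeasure lam := ⟨by simp [lam]⟩
instance : NullSingletonClass lam := by unfold lam; infer_instance

/-- copulas -/
def IsCop (π : Measure (ℝ × ℝ)) : Prop := π.map Prod.fst = lam ∧ π.map Prod.snd = lam

lemma IsCop.prob {π : Measure (ℝ × ℝ)} (h : IsCop π) : IsProbabilityMeasure π := by
  have : IsProbabilityMeasure (π.map Prod.fst) := by rw [h.1]; infer_instance
  exact Measure.isProbabilityMeasure_of_map (f := Prod.fst)

lemma IsCop.fst_apply {π : Measure (ℝ × ℝ)} (h : IsCop π) {s : Set ℝ} (hs : MeasurableSet s) :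
    π (s ×ˢ Set.univ) = lam s := by
  rw [← h.1, Measure.map_apply measurable_fst hs]; congr 1; ext; simp

lemma IsCop.snd_apply {π : Measure (ℝ × ℝ)} (h : IsCop π) {s : Set ℝ} (hs : MeasurableSet s) :
    π (Set.univ ×ˢ s) = lam s := by
  rw [← h.2, Measure.map_apply measurable_snd hs]; congr 1; ext; simp

lemma lam_le (s : Set ℝ) : lam s ≤ volume s := Measure.restrict_apply_le _ _

/-- bivariate cdf -/
def cdf2 (π : Measure (ℝ × ℝ)) (u v : ℝ) : ℝ := π.real (Set.Iic u ×ˢ Set.Iic v)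

def Hf (G : ℝ → ℝ → ℝ) (δ : ℝ) (k : ℤ) (v : ℝ) : ℝ := G ((k+1)*δ) v - G (k*δ) v + k*δ
def kk (δ u : ℝ) : ℤ := ⌈u/δ⌉ - 1
open Classical in
def Sf (G : ℝ → ℝ → ℝ) (δ u : ℝ) : ℝ :=
  if u ∈ Set.Ioo (0:ℝ) 1 then sInf {v | u ≤ Hf G δ (kk δ u) v} else 0

lemma kk_eq {δ u : ℝ} (hδ : 0 < δ) (k : ℤ) : kk δ u = k ↔ u ∈ Set.Ioc (k*δ) ((k+1)*δ) := by
  unfold kk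
  rw [sub_eq_iff_eq_add, Int.ceil_eq_iff]
  push_cast
  rw [lt_div_iff₀ hδ, div_le_iff₀ hδ]
  simp

lemma Hf_eq {π : Measure (ℝ × ℝ)} (h : IsCop π) {δ : ℝ} (hδ : 0 < δ) (k : ℤ) (v : ℝ) :
    Hf (cdf2 π) δ k v = π.real (Set.Ioc (k*δ) ((k+1)*δ) ×ˢ Set.Iic v) + k*δ := by
  have := h.prob
  unfold Hf cdf2
  have hle : (k:ℝ)*δ ≤ (k+1)*δ := by nlinarith
  have : Set.Iic ((k+1)*δ) ×ˢ Set.Iic v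
      = (Set.Iic (k*δ) ×ˢ Set.Iic v) ∪ (Set.Ioc (k*δ) ((k+1)*δ) ×ˢ Set.Iic v) := by
    rw [← Set.union_prod, Set.Iic_union_Ioc_eq_Iic hle]
  rw [this, measureReal_union]
  · ring
  · apply Set.Disjoint.set_prod_left
    exact Set.Iic_disjoint_Ioc le_rfl
  · exact measurableSet_Ioc.prod measurableSet_Iic

lemma cdf2_lip {π : Measure (ℝ × ℝ)} (h : IsCop π) (v : ℝ) {u u' : ℝ} (huu : u ≤ u') :
    |cdf2 π u' v - cdf2 π u v| ≤ u' - u := by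
  have := h.prob
  have h1 : cdf2 π u v ≤ cdf2 π u' v := by
    unfold cdf2
    exact measureReal_mono (Set.prod_mono (Set.Iic_subset_Iic.2 huu) le_rfl)
  rw [abs_of_nonneg (by linarith)]
  have : cdf2 π u' v ≤ cdf2 π u v + π.real (Set.Ioc u u' ×ˢ Set.univ) := by
    unfold cdf2
    refine le_trans (measureReal_mono ?_) (measureReal_union_le _ _)
    rintro ⟨a, b⟩ ⟨ha, hb⟩
    simp only [Set.mem_Iic] at ha hb
    by_cases hc : a ≤ u
    · left; exact ⟨hc, hb⟩
    · right; exact ⟨⟨not_le.1 hc, ha⟩, trivial⟩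
  have h2 : π.real (Set.Ioc u u' ×ˢ Set.univ) ≤ u' - u := by
    rw [measureReal_def, h.fst_apply measurableSet_Ioc]
    refine ENNReal.toReal_le_of_le_ofReal (by linarith) ((lam_le _).trans ?_)
    simp
  linarith

lemma Hf_mono {π : Measure (ℝ × ℝ)} (h : IsCop π) {δ : ℝ} (hδ : 0 < δ) (k : ℤ) :
    Monotone (Hf (cdf2 π) δ k) := by
  have := h.prob
  intro v v' hv
  rw [Hf_eq h hδ, Hf_eq h hδ]
  gcongr
  simp

lemma Hf_lip {π : Measure (ℝ × ℝ)} (h : IsCop π) {δ : ℝ} (hδ : 0 < δ) (k : ℤ) {v v' : ℝ}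
    (hv : v ≤ v') : Hf (cdf2 π) δ k v' ≤ Hf (cdf2 π) δ k v + (v' - v) := by
  have := h.prob
  rw [Hf_eq h hδ, Hf_eq h hδ]
  have : π.real (Set.Ioc (k*δ) ((k+1)*δ) ×ˢ Set.Iic v') ≤
    π.real (Set.Ioc (k*δ) ((k+1)*δ) ×ˢ Set.Iic v) + π.real (Set.univ ×ˢ Set.Ioc v v') := by
    refine le_trans (measureReal_mono ?_) (measureReal_union_le _ _)
    rintro ⟨a, b⟩ ⟨ha, hb⟩
    simp only [Set.mem_Iic] at ha hb
    by_cases hc : b ≤ v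
    · left; exact ⟨ha, hc⟩
    · right; exact ⟨trivial, ⟨not_le.1 hc, hb⟩⟩
  have h2 : π.real (Set.univ ×ˢ Set.Ioc v v') ≤ v' - v := by
    rw [measureReal_def, h.snd_apply measurableSet_Ioc]
    refine ENNReal.toReal_le_of_le_ofReal (by linarith) ((lam_le _).trans ?_)
    simp
  linarith

lemma Sf_le_iff {π : Measure (ℝ × ℝ)} (h : IsCop π) {δ : ℝ} (hδ : 0 < δ) {u : ℝ}
    (hu : u ∈ Set.Ioo (0:ℝ) 1) (v : ℝ) :
    Sf (cdf2 π) δ u ≤ v ↔ u ≤ Hf (cdf2 π) δ (kk δ u) v := by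
  have := h.prob
  obtain ⟨hk1, hk2⟩ := (kk_eq hδ (u := u) _).1 rfl
  set k := kk δ u with hk
  have hS : Sf (cdf2 π) δ u = sInf {v | u ≤ Hf (cdf2 π) δ k v} := by
    unfold Sf; rw [if_pos hu]
  rw [hS]
  have hbdd : BddBelow {v | u ≤ Hf (cdf2 π) δ k v} := by
    refine ⟨0, fun w hw => ?_⟩
    by_contra hlt
    push Not at hlt
    have h0 : π.real (Set.Ioc (k*δ) ((k+1)*δ) ×ˢ Set.Iic w) = 0 := by
      refine le_antisymm ?_ measureReal_nonneg
      calc _ ≤ π.real (Set.univ ×ˢ Set.Iic w) := measureReal_mono (by gcongr; simp)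
        _ = 0 := by
          rw [measureReal_def, h.snd_apply measurableSet_Iic, lam,
            Measure.restrict_apply measurableSet_Iic]
          have : Set.Iic w ∩ Set.Ioo (0:ℝ) 1 = ∅ := by
            ext x; simp; intro h1 h2; linarith
          simp [this]
    have : u ≤ Hf (cdf2 π) δ k w := hw
    rw [Hf_eq h hδ, h0] at this
    linarith
  have hne : (1:ℝ) ∈ {v | u ≤ Hf (cdf2 π) δ k v} := by
    change u ≤ Hf (cdf2 π) δ k 1
    rw [Hf_eq h hδ]
    have h1 : π.real (Set.Ioc (k*δ) ((k+1)*δ) ×ˢ Set.univ) ≤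
       π.real (Set.Ioc (k*δ) ((k+1)*δ) ×ˢ Set.Iic 1) + π.real (Set.univ ×ˢ Set.Ioi 1) := by
      refine le_trans (measureReal_mono ?_) (measureReal_union_le _ _)
      rintro ⟨a, b⟩ ⟨ha, hb⟩
      by_cases hc : b ≤ 1
      · left; exact ⟨ha, hc⟩
      · right; exact ⟨trivial, not_le.1 hc⟩
    have h2 : π.real (Set.univ ×ˢ Set.Ioi 1) = 0 := by
      rw [measureReal_def, h.snd_apply measurableSet_Ioi, lam,
            Measure.restrict_apply measurableSet_Ioi]
      have : Set.Ioi 1 ∩ Set.Ioo (0:ℝ) 1 = ∅ := by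
        ext x; simp; intro h1 h2; linarith
      simp [this]
    have h3 : u - k*δ ≤ π.real (Set.Ioc (k*δ) ((k+1)*δ) ×ˢ Set.univ) := by
      rw [measureReal_def, h.fst_apply measurableSet_Ioc]
      by_cases hk0 : 0 ≤ (k:ℝ)*δ
      · have : ENNReal.ofReal (u - k*δ) ≤ lam (Set.Ioc (k*δ) ((k+1)*δ)) := by
          rw [lam, Measure.restrict_apply measurableSet_Ioc]
          calc _ = volume (Set.Ioc (k*δ) u) := by simp
            _ ≤ _ := by
              apply measure_mono
              rintro x ⟨h1, h2⟩
              exact ⟨⟨h1, h2.trans hk2⟩, lt_of_le_of_lt hk0 h1, lt_of_le_of_lt h2 hu.2⟩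
        exact (ENNReal.ofReal_le_iff_le_toReal (by finiteness)).1 this
      · exfalso
        push Not at hk0
        have : (k:ℝ) < 0 := by by_contra hh; push Not at hh; nlinarith
        have : k < 0 := by exact_mod_cast this
        have : (k:ℝ) + 1 ≤ 0 := by exact_mod_cast this
        nlinarith [hu.1]
    linarith
  constructor
  · intro hle
    refine le_of_forall_pos_le_add fun e he => ?_
    obtain ⟨w, hw, hlt⟩ := (csInf_lt_iff hbdd ⟨1, hne⟩).1 (lt_of_le_of_lt hle (show v < v + e by linarith))
    have h1 : u ≤ Hf (cdf2 π) δ k w := hw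
    have h2 := Hf_mono h hδ k hlt.le
    have h3 := Hf_lip h hδ k (show v ≤ v + e by linarith)
    linarith
  · intro hle
    exact csInf_le hbdd hle

lemma Sf_measurable {π : Measure (ℝ × ℝ)} (h : IsCop π) {δ : ℝ} (hδ : 0 < δ) :
    Measurable (Sf (cdf2 π) δ) := by
  refine measurable_of_Iic fun v => ?_
  have : Sf (cdf2 π) δ ⁻¹' Set.Iic v =
    (Set.Ioo 0 1 ∩ {u | u ≤ Hf (cdf2 π) δ (kk δ u) v}) ∪ ((Set.Ioo 0 1)ᶜ ∩ {_u | 0 ≤ v}) := by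
    ext u
    by_cases hu : u ∈ Set.Ioo (0:ℝ) 1
    · have := Sf_le_iff h hδ hu v
      simp only [Set.mem_preimage, Set.mem_Iic, this]
      simp [hu.1, hu.2]
    · have : Sf (cdf2 π) δ u = 0 := by unfold Sf; rw [if_neg hu]
      simp [this, -Set.mem_Ioo, hu]
  rw [this]
  refine (measurableSet_Ioo.inter ?_).union (measurableSet_Ioo.compl.inter (by measurability))
  have hkm : Measurable (kk δ) := by unfold kk; fun_prop
  refine measurableSet_le measurable_id ?_
  exact (measurable_of_countable (fun k => Hf (cdf2 π) δ k v)).comp hkm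

lemma Sf_map_cell {π : Measure (ℝ × ℝ)} (h : IsCop π) {δ : ℝ} (hδ : 0 < δ) (k : ℤ) :
    (lam.restrict (Set.Ioc (k*δ) ((k+1)*δ))).map (Sf (cdf2 π) δ) =
      (π.restrict (Set.Ioc (k*δ) ((k+1)*δ) ×ˢ Set.univ)).map Prod.snd := by
  have := h.prob
  refine Measure.ext_of_Iic _ _ fun v => ?_
  rw [Measure.map_apply (Sf_measurable h hδ) measurableSet_Iic,
    Measure.map_apply measurable_snd measurableSet_Iic,
    Measure.restrict_apply (Sf_measurable h hδ measurableSet_Iic),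
    Measure.restrict_apply (measurable_snd measurableSet_Iic)]
  have e1 : Prod.snd ⁻¹' Set.Iic v ∩ Set.Ioc (k*δ) ((k+1)*δ) ×ˢ Set.univ
     = Set.Ioc (k*δ) ((k+1)*δ) ×ˢ Set.Iic v := by
    ext ⟨a, b⟩; simp; tauto
  rw [e1]
  set p := π (Set.Ioc (k*δ) ((k+1)*δ) ×ˢ Set.Iic v) with hp
  have hH := Hf_eq h hδ k v
  have hple : p ≤ lam (Set.Ioc (k*δ) ((k+1)*δ)) := by
    rw [← h.fst_apply measurableSet_Ioc]; exact measure_mono (by gcongr; simp)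
  have hple2 : p.toReal ≤ (lam (Set.Ioc (k*δ) ((k+1)*δ))).toReal :=
    ENNReal.toReal_mono (by finiteness) hple
  have e2 : lam (Sf (cdf2 π) δ ⁻¹' Set.Iic v ∩ Set.Ioc (k*δ) ((k+1)*δ)) =
     lam (Set.Ioc (k*δ) (k*δ + p.toReal)) := by
    have hub : p.toReal ≤ δ := by
      refine hple2.trans (ENNReal.toReal_le_of_le_ofReal hδ.le ((lam_le _).trans ?_))
      simp; apply le_of_eq; congr 1; ring
    rw [lam, Measure.restrict_apply ((Sf_measurable h hδ measurableSet_Iic).inter measurableSet_Ioc),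
      Measure.restrict_apply measurableSet_Ioc]
    congr 1
    ext u
    simp only [Set.mem_inter_iff, Set.mem_preimage, Set.mem_Iic]
    constructor
    · rintro ⟨⟨h1, h2⟩, h3⟩
      refine ⟨⟨h2.1, ?_⟩, h3⟩
      rw [Sf_le_iff h hδ h3, (kk_eq hδ k).2 h2, hH] at h1
      simp only [measureReal_def] at h1; linarith
    · rintro ⟨h2, h3⟩
      have h4 : u ∈ Set.Ioc (k*δ) ((k+1)*δ) := ⟨h2.1, h2.2.trans (by linarith)⟩
      refine ⟨⟨?_, h4⟩, h3⟩
      rw [Sf_le_iff h hδ h3, (kk_eq hδ k).2 h4, hH]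
      simp only [measureReal_def]; linarith [h2.2]
  rw [e2]
  by_cases hp0 : p = 0
  · simp [hp0]
  have hlp : 0 < lam (Set.Ioc (k*δ) ((k+1)*δ)) := lt_of_lt_of_le (pos_iff_ne_zero.2 hp0) hple
  -- cell meets the unit interval
  have hk0 : 0 ≤ (k:ℝ)*δ := by
    by_contra hk0
    push Not at hk0
    have : (k:ℝ) < 0 := by by_contra hh; push Not at hh; nlinarith
    have : k < 0 := by exact_mod_cast this
    have : (k:ℝ) + 1 ≤ 0 := by exact_mod_cast this
    rw [lam, Measure.restrict_apply measurableSet_Ioc] at hlp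
    have : Set.Ioc (k*δ) ((k+1)*δ) ∩ Set.Ioo (0:ℝ) 1 = ∅ := by
      ext x; simp; intro h1 h2 h3; nlinarith
    simp [this] at hlp
  have hl1 : (lam (Set.Ioc (k*δ) ((k+1)*δ))) ≤ ENNReal.ofReal (1 - k*δ) := by
    rw [lam, Measure.restrict_apply measurableSet_Ioc]
    calc _ ≤ volume (Set.Ioo (k*δ) 1) := measure_mono (fun x hx => ⟨hx.1.1, hx.2.2⟩)
      _ = _ := by simp
  have hk1 : p.toReal ≤ 1 - k*δ := by
    by_cases hh : 0 ≤ 1 - k*δ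
    · exact hple2.trans (ENNReal.toReal_le_of_le_ofReal hh hl1)
    · rw [ENNReal.ofReal_of_nonpos (by linarith)] at hl1
      exact absurd (lt_of_lt_of_le hlp hl1) (by simp)
  rw [lam, restrict_Ioo_eq_restrict_Ioc, Measure.restrict_apply measurableSet_Ioc]
  have : Set.Ioc (k*δ) (k*δ + p.toReal) ∩ Set.Ioc (0:ℝ) 1 = Set.Ioc (k*δ) (k*δ + p.toReal) := by
    apply Set.inter_eq_left.2
    rintro x ⟨h1, h2⟩
    exact ⟨by linarith, by linarith⟩
  rw [this]
  simp [hp]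

lemma cell_decomp {α : Type*} [MeasurableSpace α] (m : Measure α) {f : α → ℝ} (hf : Measurable f)
    {δ : ℝ} (hδ : 0 < δ) (F : α → ENNReal) :
    ∫⁻ x, F x ∂m = ∑' k : ℤ, ∫⁻ x in f ⁻¹' (Set.Ioc (k*δ) ((k+1)*δ)), F x ∂m := by
  rw [← lintegral_iUnion (fun k => hf measurableSet_Ioc)]
  · have : (⋃ k : ℤ, f ⁻¹' (Set.Ioc (k*δ) ((k+1)*δ))) = Set.univ := by
      ext x; simp only [Set.mem_iUnion, Set.mem_univ, iff_true]
      exact ⟨kk δ (f x), (kk_eq hδ _).1 rfl⟩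
    rw [this]; simp
  · intro i j hij
    rw [Function.onFun, Set.disjoint_left]
    intro x hx hy
    exact hij (((kk_eq hδ _).2 hx).symm.trans ((kk_eq hδ _).2 hy))

lemma Sf_map {π : Measure (ℝ × ℝ)} (h : IsCop π) {δ : ℝ} (hδ : 0 < δ) :
    lam.map (Sf (cdf2 π) δ) = lam := by
  ext s hs
  conv_rhs => rw [← h.2]
  rw [← lintegral_indicator_one hs, ← lintegral_indicator_one hs,
    lintegral_map (measurable_one.indicator hs) (Sf_measurable h hδ),
    lintegral_map (measurable_one.indicator hs) measurable_snd,
    cell_decomp lam measurable_id hδ, cell_decomp π measurable_fst hδ]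
  congr 1; ext k
  have := Sf_map_cell h hδ k
  have h1 := congrArg (fun m => ∫⁻ x, s.indicator 1 x ∂m) this
  rw [lintegral_map (measurable_one.indicator hs) (Sf_measurable h hδ),
    lintegral_map (measurable_one.indicator hs) measurable_snd] at h1
  rw [Set.prod_univ] at h1
  exact h1

lemma Sf_cont {T : Type*} [TopologicalSpace T] (π : T → Measure (ℝ × ℝ)) (hπ : ∀ t, IsCop (π t))
    (δ : T → ℝ) (hδ : ∀ t, 0 < δ t) (hδc : Continuous δ)
    (hc : ∀ u v, Continuous fun t => cdf2 (π t) u v) (t₀ : T) :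
    ∀ᵐ u ∂lam, ContinuousAt (fun t => Sf (cdf2 (π t)) (δ t) u) t₀ := by
  have c1 : (Set.range fun k : ℤ => (k+1) * δ t₀).Countable := Set.countable_range _
  have c2 : (Set.range fun p : ℤ × ℚ => Hf (cdf2 (π t₀)) (δ t₀) p.1 p.2).Countable :=
    Set.countable_range _
  have hu01 : ∀ᵐ u ∂lam, u ∈ Set.Ioo (0:ℝ) 1 := by
    unfold lam; exact ae_restrict_mem measurableSet_Ioo
  have n1 := c1.ae_notMem lam
  have n2 := c2.ae_notMem lam
  have hGc : ∀ (v : ℝ) (α : T → ℝ), Continuous α → Continuous fun t => cdf2 (π t) (α t) v := by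
    intro v α hα
    rw [continuous_iff_continuousAt]
    intro t
    have h1 : Tendsto (fun s => cdf2 (π s) (α t) v) (𝓝 t) (𝓝 (cdf2 (π t) (α t) v)) :=
      (hc (α t) v).tendsto t
    have h2 : Tendsto (fun s => cdf2 (π s) (α s) v - cdf2 (π s) (α t) v) (𝓝 t) (𝓝 0) := by
      refine squeeze_zero_norm (a := fun s => |α s - α t|) (fun s => ?_) ?_
      · rw [Real.norm_eq_abs]
        rcases le_total (α t) (α s) with hh | hh
        · exact (cdf2_lip (hπ s) v hh).trans (le_abs_self _)
        · rw [abs_sub_comm, abs_sub_comm (α s)]; exact (cdf2_lip (hπ s) v hh).trans (le_abs_self _)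
      · have : Continuous fun s => |α s - α t| := by fun_prop
        simpa using this.tendsto t
    have := h2.add h1
    simpa [ContinuousAt] using this
  have hHc : ∀ k v, Continuous fun t => Hf (cdf2 (π t)) (δ t) k v := by
    intro k v
    unfold Hf
    have a1 := hGc v (fun t => (k+1) * δ t) (by fun_prop)
    have a2 := hGc v (fun t => k * δ t) (by fun_prop)
    fun_prop
  filter_upwards [hu01, n1, n2] with u hu h1 h2
  obtain ⟨k, hk⟩ : ∃ k, kk (δ t₀) u = k := ⟨_, rfl⟩
  have hkm := (kk_eq (hδ t₀) k).1 hk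
  have hev : ∀ᶠ t in 𝓝 t₀, kk (δ t) u = k := by
    have hlt : u < (k+1) * δ t₀ := lt_of_le_of_ne hkm.2 (fun e => h1 ⟨k, e.symm⟩)
    have a1 : ∀ᶠ t in 𝓝 t₀, k * δ t < u :=
      (Continuous.tendsto (f := fun t => k * δ t) (by fun_prop) t₀).eventually_lt_const hkm.1
    have a2 : ∀ᶠ t in 𝓝 t₀, u < (k+1) * δ t :=
      (Continuous.tendsto (f := fun t => (k+1) * δ t) (by fun_prop) t₀).eventually_const_lt hlt
    filter_upwards [a1, a2] with t b1 b2
    exact (kk_eq (hδ t) k).2 ⟨b1, b2.le⟩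
  refine tendsto_order.2 ⟨fun v hv => ?_, fun v hv => ?_⟩
  · have : Hf (cdf2 (π t₀)) (δ t₀) k v < u := by
      by_contra hcon
      push Not at hcon
      rw [← hk] at hcon
      exact absurd ((Sf_le_iff (hπ t₀) (hδ t₀) hu v).2 hcon) (not_le.2 hv)
    filter_upwards [hev, ((hHc k v).tendsto t₀).eventually_lt_const this] with t e1 e2
    by_contra hcon
    push Not at hcon
    rw [Sf_le_iff (hπ t) (hδ t) hu, e1] at hcon
    linarith
  · obtain ⟨q, hq1, hq2⟩ := exists_rat_btwn hv
    have : u < Hf (cdf2 (π t₀)) (δ t₀) k q := by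
      have := (Sf_le_iff (hπ t₀) (hδ t₀) hu q).1 hq1.le
      rw [hk] at this
      exact lt_of_le_of_ne this (fun e => h2 ⟨(k, q), e.symm⟩)
    filter_upwards [hev, ((hHc k q).tendsto t₀).eventually_const_lt this] with t e1 e2
    refine lt_of_le_of_lt ((Sf_le_iff (hπ t) (hδ t) hu q).2 ?_) hq2
    rw [e1]; exact e2.le

section sk
variable {I Y : Type*} [MetricSpace Y]

def PS (f : PartitionOfUnity I Y) (A : Set I) (y : Y) : ℝ := ∑ᶠ j, A.indicator (fun j => f j y) j

lemma PS_eq (f : PartitionOfUnity I Y) (A : Set I) (y : Y) (s : Finset I)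
    (hs : ∀ j ∈ A, f j y ≠ 0 → j ∈ s) :
    PS f A y = ∑ j ∈ s, A.indicator (fun j => f j y) j := by
  unfold PS
  apply finsum_eq_sum_of_support_subset
  intro j hj
  rw [Function.mem_support] at hj
  have h1 := Set.mem_of_indicator_ne_zero hj
  rw [Set.indicator_of_mem h1] at hj
  exact hs j h1 hj

lemma exists_fs (f : PartitionOfUnity I Y) (y : Y) : ∃ s : Finset I, ∀ j, f j y ≠ 0 → j ∈ s :=
  ⟨(f.locallyFinite.point_finite y).toFinset, fun j hj => by simpa using hj⟩

lemma PS_cont (f : PartitionOfUnity I Y) (A : Set I) : Continuous (PS f A) := by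
  unfold PS
  refine continuous_finsum (f := fun j y => A.indicator (fun j => f j y) j) ?_ ?_
  · intro j
    by_cases hj : j ∈ A
    · simp only [Set.indicator_of_mem hj]; exact (f j).continuous
    · simp only [Set.indicator_of_notMem hj]; exact continuous_const
  · refine f.locallyFinite.subset fun j y hy => ?_
    rw [Function.mem_support] at hy ⊢
    intro h0
    apply hy
    by_cases hj : j ∈ A
    · rw [Set.indicator_of_mem hj]; exact h0
    · rw [Set.indicator_of_notMem hj]

lemma PS_nonneg (f : PartitionOfUnity I Y) (A : Set I) (y : Y) : 0 ≤ PS f A y :=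
  finsum_nonneg fun j => Set.indicator_nonneg (fun j _ => f.nonneg j y) j

lemma PS_univ (f : PartitionOfUnity I Y) (y : Y) : PS f Set.univ y = 1 := by
  unfold PS; simp only [Set.indicator_univ]; exact f.sum_eq_one (Set.mem_univ y)

lemma PS_mono (f : PartitionOfUnity I Y) {A B : Set I} (h : A ⊆ B) (y : Y) :
    PS f A y ≤ PS f B y := by
  obtain ⟨s, hs⟩ := exists_fs f y
  rw [PS_eq f A y s (fun j _ => hs j), PS_eq f B y s (fun j _ => hs j)]
  refine Finset.sum_le_sum fun j _ => ?_
  exact Set.indicator_le_indicator_of_subset h (fun j => f.nonneg j y) j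

lemma PS_le_one (f : PartitionOfUnity I Y) (A : Set I) (y : Y) : PS f A y ≤ 1 := by
  rw [← PS_univ f y]; exact PS_mono f (Set.subset_univ _) y

lemma PS_finset (f : PartitionOfUnity I Y) (s : Finset I) (y : Y) :
    PS f (s : Set I) y = ∑ j ∈ s, f j y := by
  rw [PS_eq f _ y s (fun j hj _ => hj)]
  exact Finset.sum_congr rfl fun j hj => Set.indicator_of_mem (by exact hj) _

lemma PS_insert (f : PartitionOfUnity I Y) {A : Set I} {i : I} (hi : i ∉ A) (y : Y) :
    PS f (insert i A) y = PS f A y + f i y := by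
  classical
  obtain ⟨s, hs⟩ := exists_fs f y
  rw [PS_eq f A y (insert i s) (fun j _ h => Finset.mem_insert_of_mem (hs j h)),
    PS_eq f _ y (insert i s) (fun j _ h => Finset.mem_insert_of_mem (hs j h))]
  have : ∀ j, (insert i A).indicator (fun j => f j y) j =
      A.indicator (fun j => f j y) j + ({i} : Set I).indicator (fun j => f j y) j := by
    intro j
    by_cases h1 : j = i
    · subst h1; simp [hi]
    · by_cases h2 : j ∈ A <;> simp [h1, h2]
  simp only [this, Finset.sum_add_distrib]
  congr 1
  rw [Finset.sum_eq_single i]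
  · simp
  · intro j _ hj; simp [hj]
  · intro h; simp at h

variable (f : ℕ → PartitionOfUnity I Y) [LinearOrder I]

def wt : List I → Y → ℝ
  | [] => fun _ => 1
  | i :: l => fun y => wt l y * f l.length i y

def bs : List I → Y → ℝ
  | [] => fun _ => 0
  | i :: l => fun y => bs l y + wt f l y * PS (f l.length) (Set.Iio i) y

lemma wt_cont (l : List I) : Continuous (wt f l) := by
  induction l with
  | nil => exact continuous_const
  | cons i l ih => exact ih.mul (f l.length i).continuous

lemma bs_cont (l : List I) : Continuous (bs f l) := by
  induction l with
  | nil => exact continuous_const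
  | cons i l ih => exact ih.add ((wt_cont f l).mul (PS_cont _ _))

lemma wt_nonneg (l : List I) (y : Y) : 0 ≤ wt f l y := by
  induction l with
  | nil => exact zero_le_one
  | cons i l ih => exact mul_nonneg ih ((f l.length).nonneg i y)

lemma bs_nonneg (l : List I) (y : Y) : 0 ≤ bs f l y := by
  induction l with
  | nil => exact le_rfl
  | cons i l ih => exact add_nonneg ih (mul_nonneg (wt_nonneg f l y) (PS_nonneg _ _ y))

lemma child_le (l : List I) (i : I) (y : Y) :
    bs f (i :: l) y + wt f (i :: l) y ≤ bs f l y + wt f l y := by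
  have h1 : bs f (i :: l) y + wt f (i :: l) y
      = bs f l y + wt f l y * PS (f l.length) (insert i (Set.Iio i)) y := by
    rw [PS_insert _ (by simp)]; simp only [bs, wt]; ring
  rw [h1]
  have := mul_le_mul_of_nonneg_left (PS_le_one (f l.length) (insert i (Set.Iio i)) y)
    (wt_nonneg f l y)
  linarith

lemma bw_le_one (l : List I) (y : Y) : bs f l y + wt f l y ≤ 1 := by
  induction l with
  | nil => simp [bs, wt]
  | cons i l ih => exact (child_le f l i y).trans ih

lemma child_sep (l : List I) {i j : I} (h : i < j) (y : Y) :
    bs f (i :: l) y + wt f (i :: l) y ≤ bs f (j :: l) y := by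
  have h1 : bs f (i :: l) y + wt f (i :: l) y
      = bs f l y + wt f l y * PS (f l.length) (insert i (Set.Iio i)) y := by
    rw [PS_insert _ (by simp)]; simp only [bs, wt]; ring
  rw [h1]
  have : PS (f l.length) (insert i (Set.Iio i)) y ≤ PS (f l.length) (Set.Iio j) y := by
    apply PS_mono
    intro x hx
    rcases hx with rfl | hx
    · exact h
    · exact lt_trans hx h
  have := mul_le_mul_of_nonneg_left this (wt_nonneg f l y)
  simp only [bs]; linarith

lemma wt_le_one (l : List I) (y : Y) : wt f l y ≤ 1 := by
  have := bw_le_one f l y; have := bs_nonneg f l y; linarith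

lemma bs_le_one (l : List I) (y : Y) : bs f l y ≤ 1 := by
  have := bw_le_one f l y; have := wt_nonneg f l y; linarith

lemma sum_wt_le (n : ℕ) : ∀ (S : Finset (List I)), (∀ l ∈ S, l.length = n) → ∀ y,
    ∑ l ∈ S, wt f l y ≤ 1 := by
  classical
  induction n with
  | zero =>
    intro S hS y
    have : S ⊆ {[]} := fun l hl => by
      have := hS l hl
      rw [List.length_eq_zero_iff] at this; simp [this]
    calc _ ≤ ∑ l ∈ {([] : List I)}, wt f l y :=
          Finset.sum_le_sum_of_subset_of_nonneg this fun l _ _ => wt_nonneg f l y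
      _ = 1 := by simp [wt]
  | succ n ih =>
    intro S hS y
    by_cases hne : Nonempty I
    swap
    · have : S = ∅ := by
        apply Finset.eq_empty_of_forall_notMem
        intro l hl
        rcases l with _ | ⟨i, l⟩
        · have := hS _ hl; simp at this
        · exact hne ⟨i⟩
      simp [this]
    have i0 : Inhabited I := Classical.inhabited_of_nonempty hne
    set A := S.image List.head! 
    set B := S.image List.tail
    have hB : ∀ l ∈ B, l.length = n := by
      intro l hl
      obtain ⟨m, hm, rfl⟩ := Finset.mem_image.1 hl
      have := hS m hm; simp [this]
    have hsub : S ⊆ (A ×ˢ B).image (fun p => p.1 :: p.2) := by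
      intro l hl
      rcases l with _ | ⟨i, l⟩
      · have := hS _ hl; simp at this
      · refine Finset.mem_image.2 ⟨(i, l), Finset.mem_product.2 ⟨?_, ?_⟩, rfl⟩
        · exact Finset.mem_image.2 ⟨_, hl, rfl⟩
        · exact Finset.mem_image.2 ⟨_, hl, rfl⟩
    calc _ ≤ ∑ l ∈ (A ×ˢ B).image (fun p => p.1 :: p.2), wt f l y :=
          Finset.sum_le_sum_of_subset_of_nonneg hsub fun l _ _ => wt_nonneg f l y
      _ = ∑ p ∈ A ×ˢ B, wt f (p.1 :: p.2) y := by
          apply Finset.sum_image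
          rintro ⟨a, b⟩ _ ⟨c, d⟩ _ h
          simpa using h
      _ = ∑ l ∈ B, ∑ i ∈ A, wt f l y * f n i y := by
          rw [Finset.sum_product_right]
          refine Finset.sum_congr rfl fun l hl => Finset.sum_congr rfl fun i _ => ?_
          simp only [wt, hB l hl]
      _ = (∑ l ∈ B, wt f l y) * ∑ i ∈ A, f n i y := by
          rw [Finset.sum_mul_sum]
      _ ≤ 1 := by
          refine mul_le_one₀ (ih B hB y) ?_ ?_
          · exact Finset.sum_nonneg fun i _ => (f n).nonneg i y
          · rw [← PS_finset]; exact PS_le_one _ _ _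

variable [MeasurableSpace Y] [BorelSpace Y] (ν : Measure Y) [IsProbabilityMeasure ν]

lemma int_of_bdd {g : Y → ℝ} (hg : Continuous g) (h0 : ∀ y, 0 ≤ g y) (h1 : ∀ y, g y ≤ 1) :
    Integrable g ν :=
  Integrable.of_bound hg.aestronglyMeasurable 1 (Eventually.of_forall fun y => by
    rw [Real.norm_eq_abs, abs_of_nonneg (h0 y)]; exact h1 y)

def Iv (l : List I) : Set ℝ := Set.Ico (∫ y, bs f l y ∂ν) (∫ y, bs f l y ∂ν + ∫ y, wt f l y ∂ν)

lemma int_bs (l : List I) : Integrable (bs f l) ν :=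
  int_of_bdd ν (bs_cont f l) (bs_nonneg f l) (bs_le_one f l)
lemma int_wt (l : List I) : Integrable (wt f l) ν :=
  int_of_bdd ν (wt_cont f l) (wt_nonneg f l) (wt_le_one f l)

lemma Iv_nil : Iv f ν [] = Set.Ico 0 1 := by simp [Iv, bs, wt]

lemma Iv_cons_subset (i : I) (l : List I) : Iv f ν (i :: l) ⊆ Iv f ν l := by
  unfold Iv
  refine Set.Ico_subset_Ico ?_ ?_
  · refine integral_mono (int_bs f ν l) (int_bs f ν _) fun y => ?_
    have := mul_nonneg (wt_nonneg f l y) (PS_nonneg (f l.length) (Set.Iio i) y)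
    simp only [bs]; linarith
  · rw [← integral_add (int_bs f ν _) (int_wt f ν _), ← integral_add (int_bs f ν _) (int_wt f ν _)]
    exact integral_mono ((int_bs f ν _).add (int_wt f ν _)) ((int_bs f ν _).add (int_wt f ν _))
      fun y => child_le f l i y

lemma Iv_unique : ∀ (l l' : List I), l.length = l'.length → ∀ v, v ∈ Iv f ν l → v ∈ Iv f ν l' →
    l = l' := by
  intro l
  induction l with
  | nil =>
    intro l' h v _ _
    exact (List.length_eq_zero_iff.1 (by simpa using h.symm)).symm
  | cons i l ih =>
    intro l' h v hv hv'
    rcases l' with _ | ⟨j, l'⟩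
    · simp at h
    · have hl : l = l' := ih l' (by simpa using h) v (Iv_cons_subset f ν i l hv)
        (Iv_cons_subset f ν j l' hv')
      subst hl
      have key : ∀ a b : I, a < b → v ∈ Iv f ν (a :: l) → v ∈ Iv f ν (b :: l) → False := by
        intro a b hab ha hb
        have h1 := ha.2
        have h2 := hb.1
        rw [← integral_add (int_bs f ν _) (int_wt f ν _)] at h1
        have := integral_mono ((int_bs f ν (a :: l)).add (int_wt f ν _)) (int_bs f ν (b :: l))
          (fun y => child_sep f l hab y)
        simp only [Pi.add_apply] at this
        linarith
      rcases lt_trichotomy i j with hij | hij | hij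
      · exact (key i j hij hv hv').elim
      · rw [hij]
      · exact (key j i hij hv' hv).elim

lemma PS_approx [ν.InnerRegular] (f : PartitionOfUnity I Y) {w : Y → ℝ} (hw : Continuous w)
    (h0 : ∀ y, 0 ≤ w y) (h1 : ∀ y, w y ≤ 1) (A : Set I) {e : ℝ} (he : 0 < e) :
    ∃ s : Finset I, (s : Set I) ⊆ A ∧
      ∫ y, w y * PS f A y ∂ν ≤ ∫ y, w y * PS f (s : Set I) y ∂ν + e := by
  classical
  obtain ⟨C, -, hC, hCe⟩ := MeasurableSet.exists_lt_isCompact (μ := ν) MeasurableSet.univ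
    (r := 1 - ENNReal.ofReal e) (by
      rw [measure_univ]; exact ENNReal.sub_lt_self (by simp) (by simp) (by simpa using he))
  have hCm := hC.isClosed.measurableSet
  have hCc : ν Cᶜ ≤ ENNReal.ofReal e := by
    rw [measure_compl hCm (by finiteness), measure_univ, tsub_le_iff_left]
    exact tsub_le_iff_right.1 hCe.le
  have hfin := f.locallyFinite.finite_nonempty_inter_compact hC
  refine ⟨hfin.toFinset.filter (· ∈ A), by intro x; simp, ?_⟩
  set s := hfin.toFinset.filter (· ∈ A)
  have i1 : ∀ B : Set I, Integrable (fun y => w y * PS f B y) ν := fun B =>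
    int_of_bdd ν (hw.mul (PS_cont f B)) (fun y => mul_nonneg (h0 y) (PS_nonneg _ _ _))
      (fun y => mul_le_one₀ (h1 y) (PS_nonneg _ _ _) (PS_le_one _ _ _))
  have i2 : Integrable (Cᶜ.indicator (fun _ => (1:ℝ))) ν :=
    (integrable_const 1).indicator hCm.compl
  have : ∫ y, Cᶜ.indicator (fun _ => (1:ℝ)) y ∂ν ≤ e := by
    rw [integral_indicator hCm.compl]
    simp only [integral_const, smul_eq_mul, mul_one, measureReal_restrict_apply_univ]
    exact ENNReal.toReal_le_of_le_ofReal he.le hCc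
  refine le_trans ?_ (add_le_add_right this _)
  rw [← integral_add (i1 _) i2]
  refine integral_mono (i1 _) ((i1 _).add i2) fun y => ?_
  simp only [Pi.add_apply]
  by_cases hy : y ∈ C
  · have : PS f A y = PS f (s : Set I) y := by
      rw [PS_finset, PS_eq f A y s]
      · refine Finset.sum_congr rfl fun j hj => Set.indicator_of_mem ?_ _
        exact (Finset.mem_filter.1 hj).2
      · intro j hj hne
        refine Finset.mem_filter.2 ⟨?_, hj⟩
        rw [Set.Finite.mem_toFinset]
        exact ⟨y, hne, hy⟩
    simp [this, hy]
  · simp only [Set.mem_compl_iff, hy, not_false_eq_true, Set.indicator_of_mem]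
    have a1 := mul_le_one₀ (h1 y) (PS_nonneg f A y) (PS_le_one f A y)
    have a2 := mul_nonneg (h0 y) (PS_nonneg f (s : Set I) y)
    change w y * PS f A y ≤ w y * PS f (s : Set I) y + 1
    linarith

lemma Iv_child [WellFoundedLT I] [ν.InnerRegular] (l : List I) (v : ℝ) (hv : v ∈ Iv f ν l) :
    ∃ i, v ∈ Iv f ν (i :: l) := by
  classical
  have i1 : ∀ B : Set I, Integrable (fun y => wt f l y * PS (f l.length) B y) ν := fun B =>
    int_of_bdd ν ((wt_cont f l).mul (PS_cont _ B))
      (fun y => mul_nonneg (wt_nonneg f l y) (PS_nonneg _ _ _))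
      (fun y => mul_le_one₀ (wt_le_one f l y) (PS_nonneg _ _ _) (PS_le_one _ _ _))
  have hbi : ∀ i, ∫ y, bs f (i :: l) y ∂ν =
      ∫ y, bs f l y ∂ν + ∫ y, wt f l y * PS (f l.length) (Set.Iio i) y ∂ν := by
    intro i; rw [← integral_add (int_bs f ν l) (i1 _)]; rfl
  have hwi : ∀ i, ∫ y, bs f (i :: l) y ∂ν + ∫ y, wt f (i :: l) y ∂ν =
      ∫ y, bs f l y ∂ν + ∫ y, wt f l y * PS (f l.length) (Set.Iic i) y ∂ν := by
    intro i
    rw [← integral_add (int_bs f ν _) (int_wt f ν _), ← integral_add (int_bs f ν l) (i1 _)]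
    congr 1; ext y
    rw [← Set.Iio_insert, PS_insert _ (by simp)]; simp only [bs, wt]; ring
  -- if the integral over A exceeds v then so does that over some Iic j, j in A
  have key : ∀ A : Set I, v < ∫ y, bs f l y ∂ν + ∫ y, wt f l y * PS (f l.length) A y ∂ν →
      ∃ j ∈ A, v < ∫ y, bs f l y ∂ν + ∫ y, wt f l y * PS (f l.length) (Set.Iic j) y ∂ν := by
    intro A hA
    set e := (∫ y, bs f l y ∂ν + ∫ y, wt f l y * PS (f l.length) A y ∂ν - v) / 2 with he
    have hepos : 0 < e := by rw [he]; linarith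
    obtain ⟨s, hsA, hs⟩ := PS_approx ν (f l.length) (wt_cont f l) (wt_nonneg f l) (wt_le_one f l)
      A hepos
    have hs2 : v < ∫ y, bs f l y ∂ν + ∫ y, wt f l y * PS (f l.length) (s : Set I) y ∂ν := by
      linarith
    rcases s.eq_empty_or_nonempty with rfl | hne
    · have : ∀ y, PS (f l.length) ((∅ : Finset I) : Set I) y = 0 := by
        intro y; rw [PS_finset]; simp
      simp only [this, mul_zero, integral_zero, add_zero] at hs2
      exact absurd hs2 (not_lt.2 hv.1)
    · refine ⟨s.max' hne, hsA (s.max'_mem hne), hs2.trans_le ?_⟩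
      gcongr
      · exact i1 _
      · exact i1 _
      · intro y
        refine mul_le_mul_of_nonneg_left (PS_mono _ ?_ y) (wt_nonneg f l y)
        intro j hj
        exact s.le_max' j hj
  obtain ⟨j, -, hj⟩ := key Set.univ (by simpa [PS_univ] using hv.2)
  obtain ⟨i, hi, hmin⟩ := WellFounded.has_min (wellFounded_lt (α := I))
    {j | v < ∫ y, bs f l y ∂ν + ∫ y, wt f l y * PS (f l.length) (Set.Iic j) y ∂ν} ⟨j, hj⟩
  refine ⟨i, ?_, ?_⟩
  · by_contra hcon
    push Not at hcon
    rw [hbi] at hcon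
    obtain ⟨k, hk, hk2⟩ := key _ hcon
    exact hmin k hk2 hk
  · rw [hwi]; exact hi

end sk

set_option linter.unusedSectionVars false
set_option linter.deprecated false
lemma lam_Ico_compl : lam (Set.Ico (0:ℝ) 1)ᶜ = 0 := by
  rw [lam, Measure.restrict_apply measurableSet_Ico.compl]
  convert measure_empty (μ := (volume : Measure ℝ))
  ext x; simp only [Set.mem_inter_iff, Set.mem_compl_iff, Set.mem_Ico, Set.mem_Ioo]
  constructor
  · rintro ⟨h1, h2, h3⟩; exact h1 ⟨h2.le, h3⟩
  · intro h; exact h.elim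

section sk2
variable {I Y : Type*} [MetricSpace Y] [LinearOrder I] [Inhabited I]
  [MeasurableSpace Y] (f : ℕ → PartitionOfUnity I Y) (c : I → Y) (ν : Measure Y)

open Classical in
def hd (v : ℝ) (l : List I) : I :=
  if h : ∃ i, v ∈ Iv f ν (i :: l) then Classical.choose h else default

def br (v : ℝ) : ℕ → List I
  | 0 => []
  | n + 1 => hd f ν v (br v n) :: br v n

def cn (v : ℝ) (n : ℕ) : Y := c (hd f ν v (br f ν v n))

open Classical in
def xi (v : ℝ) : Y :=
  if h : v ∈ Set.Ico (0:ℝ) 1 ∧ ∃ y, Tendsto (cn f c ν v) atTop (𝓝 y) then Classical.choose h.2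
  else c default

lemma br_len (v : ℝ) (n : ℕ) : (br f ν v n).length = n := by
  induction n with
  | zero => rfl
  | succ n ih => simp [br, ih]

variable [BorelSpace Y] [IsProbabilityMeasure ν]

lemma Iv_sub (l : List I) : Iv f ν l ⊆ Set.Ico 0 1 := by
  induction l with
  | nil => rw [Iv_nil]
  | cons i l ih => exact (Iv_cons_subset f ν i l).trans ih

variable [WellFoundedLT I] [ν.InnerRegular]

lemma br_mem {v : ℝ} (hv : v ∈ Set.Ico (0:ℝ) 1) (n : ℕ) : v ∈ Iv f ν (br f ν v n) := by
  induction n with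
  | zero => rw [br, Iv_nil]; exact hv
  | succ n ih =>
    have := Iv_child f ν _ v ih
    rw [br, hd, dif_pos this]
    exact Classical.choose_spec this

lemma br_eq {v : ℝ} {l : List I} (hv : v ∈ Iv f ν l) : br f ν v l.length = l :=
  Iv_unique f ν _ _ (br_len f ν v _) v (br_mem f ν (Iv_sub f ν l hv) _) hv

lemma exists_wt {l : List I} {v : ℝ} (hv : v ∈ Iv f ν l) : ∃ y, wt f l y ≠ 0 := by
  by_contra! hcon
  have : ∫ y, wt f l y ∂ν = 0 := by simp [hcon]
  rw [Iv, this] at hv; simp at hv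

variable (hc : ∀ n i y, f n i y ≠ 0 → dist y (c i) < (1 / 2) ^ n)
include hc

lemma wt_dist {v : ℝ} {n : ℕ} {y : Y} (h : wt f (br f ν v (n + 1)) y ≠ 0) :
    dist y (cn f c ν v n) < (1 / 2) ^ n ∧ wt f (br f ν v n) y ≠ 0 := by
  rw [br, wt] at h
  refine ⟨?_, left_ne_zero_of_mul h⟩
  have := hc _ _ _ (right_ne_zero_of_mul h)
  rwa [br_len] at this

lemma cn_dist {v : ℝ} (hv : v ∈ Set.Ico (0:ℝ) 1) (n : ℕ) :
    dist (cn f c ν v n) (cn f c ν v (n + 1)) ≤ 2 * (1 / 2) ^ n := by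
  obtain ⟨y, hy⟩ := exists_wt f ν (br_mem f ν hv (n + 2))
  obtain ⟨h1, h2⟩ := wt_dist f c ν hc hy
  obtain ⟨h3, -⟩ := wt_dist f c ν hc h2
  have := dist_triangle_left (cn f c ν v n) (cn f c ν v (n + 1)) y
  have h4 : ((1:ℝ) / 2) ^ (n + 1) = (1 / 2) ^ n / 2 := by rw [pow_succ]; ring
  have h5 : (0:ℝ) < (1 / 2) ^ n := by positivity
  linarith

variable [CompleteSpace Y]

lemma xi_tendsto {v : ℝ} (hv : v ∈ Set.Ico (0:ℝ) 1) :
    Tendsto (cn f c ν v) atTop (𝓝 (xi f c ν v)) := by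
  have h : v ∈ Set.Ico (0:ℝ) 1 ∧ ∃ y, Tendsto (cn f c ν v) atTop (𝓝 y) :=
    ⟨hv, cauchySeq_tendsto_of_complete
      (cauchySeq_of_le_geometric (1 / 2) 2 (by norm_num) (cn_dist f c ν hc hv))⟩
  rw [xi, dif_pos h]; exact Classical.choose_spec h.2

lemma xi_dist {v : ℝ} (hv : v ∈ Set.Ico (0:ℝ) 1) (n : ℕ) :
    dist (cn f c ν v n) (xi f c ν v) ≤ 4 * (1 / 2) ^ n := by
  have := dist_le_of_le_geometric_of_tendsto (1 / 2) 2 (by norm_num) (cn_dist f c ν hc hv)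
    (xi_tendsto f c ν hc hv) n
  have h2 : 2 * ((1:ℝ) / 2) ^ n / (1 - 1 / 2) = 4 * (1 / 2) ^ n := by ring
  rwa [h2] at this

omit hc
omit [CompleteSpace Y] [Inhabited I] [WellFoundedLT I] [ν.InnerRegular] [IsProbabilityMeasure ν] in
lemma tsum_wt_le (n : ℕ) (S : Set (List I)) (hS : ∀ l ∈ S, l.length = n) (y : Y) :
    ∑' l : S, ENNReal.ofReal (wt f l.1 y) ≤ 1 := by
  classical
  rw [ENNReal.tsum_eq_iSup_sum]
  refine iSup_le fun s => ?_
  rw [← ENNReal.ofReal_sum_of_nonneg (fun l _ => wt_nonneg f _ y), ← ENNReal.ofReal_one]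
  apply ENNReal.ofReal_le_ofReal
  have := sum_wt_le f n (s.map (Function.Embedding.subtype _)) (by
    intro l hl
    obtain ⟨a, _, rfl⟩ := Finset.mem_map.1 hl
    exact hS _ a.2) y
  simpa using this

lemma Iv_countable (n : ℕ) : {l : List I | l.length = n ∧ (Iv f ν l).Nonempty}.Countable := by
  set S := {l : List I | l.length = n}
  have h1 : ∑' l : S, ENNReal.ofReal (∫ y, wt f l.1 y ∂ν) ≤ 1 := by
    rw [ENNReal.tsum_eq_iSup_sum]
    refine iSup_le fun s => ?_
    have : ∀ l : List I, ENNReal.ofReal (∫ y, wt f l y ∂ν) = ∫⁻ y, ENNReal.ofReal (wt f l y) ∂ν :=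
      fun l => ofReal_integral_eq_lintegral_ofReal (int_wt f ν l)
        (Eventually.of_forall (wt_nonneg f l))
    simp only [this]
    rw [← lintegral_finsetSum _ (fun l _ => (wt_cont f l.1).measurable.ennreal_ofReal)]
    calc _ ≤ ∫⁻ y, 1 ∂ν := lintegral_mono fun y =>
          (ENNReal.sum_le_tsum s).trans (tsum_wt_le f n S (fun l h => h) y)
      _ = 1 := by simp
  have h2 := Summable.countable_support_ennreal (h1.trans_lt ENNReal.one_lt_top).ne
  refine (h2.image Subtype.val).mono ?_
  rintro l ⟨hl, v, hv⟩
  refine ⟨⟨l, hl⟩, ?_, rfl⟩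
  rw [Function.mem_support]
  have : 0 < ∫ y, wt f l y ∂ν := by have := hv.1; have := hv.2; linarith
  simpa using this

lemma br_set (n : ℕ) (P : List I → Prop) :
    {v | v ∈ Set.Ico (0:ℝ) 1 ∧ P (br f ν v n)} =
      ⋃ l ∈ {l : List I | (l.length = n ∧ (Iv f ν l).Nonempty) ∧ P l}, Iv f ν l := by
  ext v
  simp only [Set.mem_setOf_eq, Set.mem_iUnion, exists_prop]
  constructor
  · rintro ⟨hv, hP⟩
    exact ⟨_, ⟨⟨br_len f ν v n, v, br_mem f ν hv n⟩, hP⟩, br_mem f ν hv n⟩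
  · rintro ⟨l, ⟨⟨rfl, _⟩, hP⟩, hv⟩
    exact ⟨Iv_sub f ν l hv, by rw [br_eq f ν hv]; exact hP⟩

lemma br_meas (n : ℕ) (P : List I → Prop) :
    MeasurableSet {v | v ∈ Set.Ico (0:ℝ) 1 ∧ P (br f ν v n)} := by
  rw [br_set]
  exact MeasurableSet.biUnion ((Iv_countable f ν n).mono fun l h => h.1) fun l _ => measurableSet_Ico

lemma br_lam (n : ℕ) (P : List I → Prop) (A : Set Y) (hA : MeasurableSet A)
    (hP : ∀ l, P l → ∀ y, wt f l y ≠ 0 → y ∈ A) :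
    lam {v | v ∈ Set.Ico (0:ℝ) 1 ∧ P (br f ν v n)} ≤ ν A := by
  rw [br_set]
  set S := {l : List I | (l.length = n ∧ (Iv f ν l).Nonempty) ∧ P l}
  have hSc : S.Countable := (Iv_countable f ν n).mono fun l h => h.1
  have : Countable S := hSc.to_subtype
  calc _ ≤ ∑' l : S, lam (Iv f ν l.1) := measure_biUnion_le _ hSc _
    _ ≤ ∑' l : S, ∫⁻ y, ENNReal.ofReal (wt f l.1 y) ∂ν := by
        refine ENNReal.tsum_le_tsum fun l => (lam_le _).trans ?_
        rw [Iv, Real.volume_Ico, add_sub_cancel_left,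
          ofReal_integral_eq_lintegral_ofReal (int_wt f ν _) (Eventually.of_forall (wt_nonneg f _))]
    _ = ∫⁻ y, ∑' l : S, ENNReal.ofReal (wt f l.1 y) ∂ν :=
        (lintegral_tsum fun l : S => (wt_cont f l.1).measurable.ennreal_ofReal.aemeasurable).symm
    _ ≤ ∫⁻ y, A.indicator 1 y ∂ν := by
        refine lintegral_mono fun y => ?_
        by_cases hy : y ∈ A
        · rw [Set.indicator_of_mem hy]; exact tsum_wt_le f n S (fun l h => h.1.1) y
        · rw [Set.indicator_of_notMem hy]
          refine le_of_eq (ENNReal.tsum_eq_zero.2 fun l => ?_)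
          have : wt f l.1 y = 0 := by
            by_contra h; exact hy (hP l.1 l.2.2 y h)
          simp [this]
    _ = ν A := by rw [lintegral_indicator_one hA]

include hc

lemma xi_meas : Measurable (xi f c ν) := by
  classical
  have h1 : ∀ n, Measurable (fun v => if v ∈ Set.Ico (0:ℝ) 1 then cn f c ν v n else c default) := by
    intro n B hB
    have : (fun v => if v ∈ Set.Ico (0:ℝ) 1 then cn f c ν v n else c default) ⁻¹' B =
        {v | v ∈ Set.Ico (0:ℝ) 1 ∧ (fun l : List I => c (l.headD default) ∈ B) (br f ν v (n+1))} ∪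
        ((Set.Ico (0:ℝ) 1)ᶜ ∩ {v | c default ∈ B}) := by
      ext v
      by_cases hv : v ∈ Set.Ico (0:ℝ) 1
      · simp only [Set.mem_preimage, hv, if_true, Set.mem_union, Set.mem_setOf_eq, true_and,
          Set.mem_inter_iff, Set.mem_compl_iff, not_true_eq_false, false_and, or_false]
        rfl
      · simp only [Set.mem_preimage, hv, if_false, Set.mem_union, Set.mem_setOf_eq, false_and,
          Set.mem_inter_iff, Set.mem_compl_iff, not_false_eq_true, true_and, false_or]
    rw [this]
    exact (br_meas f ν (n + 1) (fun l : List I => c (l.headD default) ∈ B)).union (measurableSet_Ico.compl.inter (MeasurableSet.const _))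
  refine measurable_of_tendsto_metrizable h1 (tendsto_pi_nhds.2 fun v => ?_)
  by_cases hv : v ∈ Set.Ico (0:ℝ) 1
  · simp only [hv, if_true]; exact xi_tendsto f c ν hc hv
  · simp only [hv, if_false]
    rw [xi, dif_neg (fun h => hv h.1)]; exact tendsto_const_nhds

lemma xi_map : lam.map (xi f c ν) = ν := by
  have hm := xi_meas f c ν hc
  have : IsProbabilityMeasure (lam.map (xi f c ν)) := Measure.isProbabilityMeasure_map hm.aemeasurable
  have hclosed : ∀ C : Set Y, IsClosed C → lam.map (xi f c ν) C ≤ ν C := by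
    intro C hC
    rw [Measure.map_apply hm hC.measurableSet]
    have hlim : Tendsto (fun n : ℕ => 5 * ((1:ℝ) / 2) ^ n) atTop (𝓝 0) := by
      simpa using (tendsto_pow_atTop_nhds_zero_of_lt_one (r := (1:ℝ) / 2)
        (by norm_num) (by norm_num)).const_mul 5
    have h1 := (tendsto_measure_cthickening_of_isClosed (μ := ν) (s := C)
      ⟨1, one_pos, by finiteness⟩ hC).comp hlim
    refine ge_of_tendsto' h1 fun n => ?_
    simp only [Function.comp]
    calc lam (xi f c ν ⁻¹' C) ≤ lam ({v | v ∈ Set.Ico (0:ℝ) 1 ∧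
            (fun l : List I => ∀ y, wt f l y ≠ 0 → y ∈ Metric.cthickening (5 * (1 / 2) ^ n) C)
              (br f ν v (n+1))} ∪ (Set.Ico (0:ℝ) 1)ᶜ) := by
          refine measure_mono fun v hvC => ?_
          by_cases hv : v ∈ Set.Ico (0:ℝ) 1
          · left
            refine ⟨hv, fun y hy => ?_⟩
            obtain ⟨h1, -⟩ := wt_dist f c ν hc hy
            refine Metric.mem_cthickening_of_dist_le y (xi f c ν v) _ _ hvC ?_
            have := dist_triangle y (cn f c ν v n) (xi f c ν v)
            have := xi_dist f c ν hc hv n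
            linarith
          · right; exact hv
      _ ≤ lam {v | v ∈ Set.Ico (0:ℝ) 1 ∧
            (fun l : List I => ∀ y, wt f l y ≠ 0 → y ∈ Metric.cthickening (5 * (1 / 2) ^ n) C)
              (br f ν v (n+1))} + lam (Set.Ico (0:ℝ) 1)ᶜ := measure_union_le _ _
      _ ≤ _ := by
          rw [lam_Ico_compl, add_zero]
          exact br_lam f ν (n + 1) _ _ Metric.isClosed_cthickening.measurableSet fun l h => h
  have hle : lam.map (xi f c ν) ≤ ν := by
    refine Measure.le_iff.2 fun s hs => ?_
    rw [hs.measure_eq_iSup_isClosed_of_ne_top (by finiteness)]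
    exact iSup₂_le fun C hC => iSup_le fun hCc => (hclosed C hCc).trans (measure_mono hC)
  exact Measure.eq_of_le_of_isProbabilityMeasure hle

end sk2

section sk3
variable {I Y T : Type*} [MetricSpace Y] [LinearOrder I] [Inhabited I]
  [MeasurableSpace Y] [TopologicalSpace T]
  [BorelSpace Y] [WellFoundedLT I]  [CompleteSpace Y]

lemma wcf_cont {ν : T → Measure Y} (hν : WeaklyContinuousFamily ν) {g : Y → ℝ} (hg : Continuous g)
    (h0 : ∀ y, 0 ≤ g y) (h1 : ∀ y, g y ≤ 1) : Continuous fun t => ∫ y, g y ∂(ν t) :=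
  hν (BoundedContinuousFunction.ofNormedAddCommGroup g hg 1 fun y => by
    rw [Real.norm_eq_abs, abs_of_nonneg (h0 y)]; exact h1 y)

lemma xi_cont (f : ℕ → PartitionOfUnity I Y) (c : I → Y) 
    (hc : ∀ n i y, f n i y ≠ 0 → dist y (c i) < (1 / 2) ^ n)
    (ν : T → Measure Y) (hp : ∀ t, IsProbabilityMeasure (ν t)) (hr : ∀ t, (ν t).InnerRegular)
    (hν : WeaklyContinuousFamily ν) (t₀ : T) :
    ∀ᵐ v ∂lam, ContinuousAt (fun p : T × ℝ => xi f c (ν p.1) p.2) (t₀, v) := by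
  have h1 : ∀ᵐ v ∂lam, v ∈ Set.Ico (0:ℝ) 1 := lam_Ico_compl
  have h2 : ∀ᵐ v ∂lam, ∀ n, ∀ l ∈ {l : List I | l.length = n ∧ (Iv f (ν t₀) l).Nonempty},
      v ≠ ∫ y, bs f l y ∂(ν t₀) := by
    rw [ae_all_iff]; intro n
    rw [ae_ball_iff (Iv_countable f (ν t₀) n)]
    intro l hl
    have : lam {∫ y, bs f l y ∂(ν t₀)} = 0 := measure_singleton _
    exact measure_eq_zero_iff_ae_notMem.1 this
  filter_upwards [h1, h2] with v hv hv2
  refine Metric.tendsto_nhds.2 fun ε hε => ?_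
  obtain ⟨n, hn⟩ := exists_pow_lt_of_lt_one (show (0:ℝ) < ε / 8 by positivity)
    (show (1:ℝ) / 2 < 1 by norm_num)
  have hmem := br_mem f (ν t₀) hv (n + 1)
  have hne := hv2 (n + 1) _ ⟨br_len f (ν t₀) v (n + 1), v, hmem⟩
  set l := br f (ν t₀) v (n + 1) with hl
  have hb := wcf_cont hν (bs_cont f l) (bs_nonneg f l) (bs_le_one f l)
  have hw := wcf_cont hν (wt_cont f l) (wt_nonneg f l) (wt_le_one f l)
  have c1 : Continuous fun p : T × ℝ => p.2 - ∫ y, bs f l y ∂(ν p.1) :=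
    continuous_snd.sub (hb.comp continuous_fst)
  have c2 : Continuous fun p : T × ℝ =>
      ∫ y, bs f l y ∂(ν p.1) + ∫ y, wt f l y ∂(ν p.1) - p.2 :=
    ((hb.comp continuous_fst).add (hw.comp continuous_fst)).sub continuous_snd
  have e1 : ∀ᶠ p : T × ℝ in 𝓝 (t₀, v), 0 < p.2 - ∫ y, bs f l y ∂(ν p.1) :=
    c1.continuousAt.eventually_const_lt (by have := lt_of_le_of_ne hmem.1 hne.symm; simpa using this)
  have e2 : ∀ᶠ p : T × ℝ in 𝓝 (t₀, v),
      0 < ∫ y, bs f l y ∂(ν p.1) + ∫ y, wt f l y ∂(ν p.1) - p.2 :=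
    c2.continuousAt.eventually_const_lt (by have := hmem.2; simpa using this)
  filter_upwards [e1, e2] with p h1 h2
  have hp' : p.2 ∈ Iv f (ν p.1) l := ⟨by linarith, by linarith⟩
  have hbr : br f (ν p.1) p.2 (n + 1) = l := by
    have := br_eq f (ν p.1) hp'
    rwa [hl, br_len, ← hl] at this
  have hcn : cn f c (ν p.1) p.2 n = cn f c (ν t₀) v n := by
    change c ((br f (ν p.1) p.2 (n+1)).headD default) = c ((br f (ν t₀) v (n+1)).headD default)
    rw [hbr]
  have d1 := xi_dist f c (ν p.1) hc (Iv_sub f _ _ hp') n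
  have d2 := xi_dist f c (ν t₀) hc hv n
  rw [hcn] at d1
  have := dist_triangle_left (xi f c (ν p.1) p.2) (xi f c (ν t₀) v) (cn f c (ν t₀) v n)
  change dist (xi f c (ν p.1) p.2) (xi f c (ν t₀) v) < ε
  linarith
end sk3

lemma lemmaA {Y T : Type*} [MetricSpace Y] [CompleteSpace Y] [MeasurableSpace Y] [BorelSpace Y]
    [TopologicalSpace T] 
    (ν : T → Measure Y) (hp : ∀ t, IsProbabilityMeasure (ν t)) (hr : ∀ t, (ν t).InnerRegular)
    (hν : WeaklyContinuousFamily ν) :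
    ∃ ξ : T → ℝ → Y, (∀ t, Measurable (ξ t)) ∧ (∀ t, lam.map (ξ t) = ν t) ∧
      ∀ t₀, ∀ᵐ v ∂lam, ContinuousAt (fun p : T × ℝ => ξ p.1 p.2) (t₀, v) := by
  rcases isEmpty_or_nonempty T with hT | ⟨⟨t0⟩⟩
  · exact ⟨fun t => (hT.false t).elim, fun t => (hT.false t).elim, fun t => (hT.false t).elim,
      fun t => (hT.false t).elim⟩
  have hY : Nonempty Y := nonempty_of_isProbabilityMeasure (ν t0)
  obtain ⟨o, ho⟩ := exists_wellFoundedLT Y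
  have : Inhabited Y := Classical.inhabited_of_nonempty hY
  have hf : ∀ n : ℕ, ∃ f : PartitionOfUnity Y Y, ∀ i y, f i y ≠ 0 → dist y i < (1 / 2) ^ n := by
    intro n
    obtain ⟨f, hf⟩ := PartitionOfUnity.exists_isSubordinate (s := (Set.univ : Set Y)) isClosed_univ
      (fun y => Metric.ball y ((1 / 2) ^ n)) (fun y => Metric.isOpen_ball)
      (fun y _ => Set.mem_iUnion.2 ⟨y, Metric.mem_ball_self (by positivity)⟩)
    exact ⟨f, fun i y hy => hf i (subset_tsupport _ hy)⟩
  choose f hf using hf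
  exact ⟨fun t => xi f id (ν t), fun t => xi_meas f id (ν t) hf, fun t => xi_map f id (ν t) hf,
    fun t₀ => xi_cont f id hf ν hp hr hν t₀⟩

lemma lam_Iic {u : ℝ} (h0 : 0 ≤ u) (h1 : u ≤ 1) : lam (Set.Iic u) = ENNReal.ofReal u := by
  rw [lam, Measure.restrict_apply measurableSet_Iic]
  apply le_antisymm
  · calc _ ≤ volume (Set.Ioc 0 u) := measure_mono (show Set.Iic u ∩ Set.Ioo 0 1 ⊆ Set.Ioc 0 u from
        fun x hx => ⟨hx.2.1, hx.1⟩)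
      _ = _ := by simp
  · calc ENNReal.ofReal u = volume (Set.Ioo 0 u) := by simp
      _ ≤ _ := measure_mono (show Set.Ioo 0 u ⊆ Set.Iic u ∩ Set.Ioo 0 1 from
        fun x hx => ⟨hx.2.le, hx.1, hx.2.trans_le h1⟩)

section cdfsec
variable (ρ : Measure ℝ) [IsProbabilityMeasure ρ] [NullSingletonClass ρ]
open ProbabilityTheory

lemma cdf_cont : Continuous (cdf ρ) := by
  rw [continuous_iff_continuousAt]
  intro x
  have h1 : ContinuousWithinAt (cdf ρ) (Set.Ici x) x := (cdf ρ).right_continuous x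
  have h2 : Function.leftLim (cdf ρ) x = cdf ρ x := by
    have h := (cdf ρ).measure_singleton x
    rw [measure_cdf, measure_singleton] at h
    have h3 := ENNReal.ofReal_eq_zero.1 h.symm
    have h4 := (monotone_cdf ρ).leftLim_le (le_refl x)
    linarith
  rw [continuousAt_iff_continuous_left'_right']
  refine ⟨?_, h1.mono Set.Ioi_subset_Ici_self⟩
  rw [(monotone_cdf ρ).continuousWithinAt_Iio_iff_leftLim_eq]; exact h2

lemma cdf_surj {u : ℝ} (h0 : 0 < u) (h1 : u < 1) : ∃ x, cdf ρ x = u := by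
  obtain ⟨a, ha⟩ := ((tendsto_cdf_atBot ρ).eventually (gt_mem_nhds h0)).exists
  obtain ⟨b, hb⟩ := ((tendsto_cdf_atTop ρ).eventually (lt_mem_nhds h1)).exists
  have := mem_range_of_exists_le_of_exists_ge (cdf_cont ρ) ⟨a, ha.le⟩ ⟨b, hb.le⟩
  exact this

lemma cdf_map : ρ.map (cdf ρ) = lam := by
  have hm := (cdf_cont ρ).measurable
  have : IsProbabilityMeasure (ρ.map (cdf ρ)) := Measure.isProbabilityMeasure_map hm.aemeasurable
  refine Measure.ext_of_Iic _ _ fun u => ?_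
  rw [Measure.map_apply hm measurableSet_Iic]
  have hup : ∀ u' : ℝ, 0 < u' → u < u' → u' < 1 → ρ (cdf ρ ⁻¹' Set.Iic u) ≤ ENNReal.ofReal u' := by
    intro u' h0 h1 h2
    obtain ⟨x, hx⟩ := cdf_surj ρ h0 h2
    rw [← hx, ofReal_cdf]
    refine measure_mono fun y hy => ?_
    by_contra hcon
    have := monotone_cdf ρ (not_le.1 hcon).le
    have : cdf ρ y ≤ u := hy
    linarith
  have hlo : ∀ u' : ℝ, 0 < u' → u' < u → u' < 1 → ENNReal.ofReal u' ≤ ρ (cdf ρ ⁻¹' Set.Iic u) := by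
    intro u' h0 h1 h2
    obtain ⟨x, hx⟩ := cdf_surj ρ h0 h2
    rw [← hx, ofReal_cdf]
    refine measure_mono fun y hy => ?_
    have := monotone_cdf ρ hy
    change cdf ρ y ≤ u
    linarith
  rcases lt_or_ge u 1 with hu1 | hu1
  · rcases lt_or_ge u 0 with hu0 | hu0
    · have h1 : cdf ρ ⁻¹' Set.Iic u = ∅ := by
        ext y; simp only [Set.mem_preimage, Set.mem_Iic, Set.mem_empty_iff_false, iff_false, not_le]
        exact hu0.trans_le (cdf_nonneg ρ y)
      rw [h1, measure_empty]
      symm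
      refine le_antisymm ?_ zero_le
      calc lam (Set.Iic u) ≤ lam (Set.Iic 0) := measure_mono (Set.Iic_subset_Iic.2 hu0.le)
        _ = 0 := by rw [lam_Iic le_rfl zero_le_one]; simp
    · rw [lam_Iic hu0 hu1.le]
      apply le_antisymm
      · have hc : Tendsto (fun u' => ENNReal.ofReal u') (𝓝[>] u) (𝓝 (ENNReal.ofReal u)) :=
          (ENNReal.continuous_ofReal.tendsto u).mono_left nhdsWithin_le_nhds
        refine ge_of_tendsto hc ?_
        filter_upwards [Ioo_mem_nhdsGT hu1] with u' hu'
        exact hup u' (hu0.trans_lt hu'.1) hu'.1 hu'.2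
      · rcases hu0.eq_or_lt with rfl | hu0
        · simp
        have hc : Tendsto (fun u' => ENNReal.ofReal u') (𝓝[<] u) (𝓝 (ENNReal.ofReal u)) :=
          (ENNReal.continuous_ofReal.tendsto u).mono_left nhdsWithin_le_nhds
        refine le_of_tendsto hc ?_
        filter_upwards [Ioo_mem_nhdsLT hu0] with u' hu'
        exact hlo u' hu'.1 hu'.2 (hu'.2.trans hu1)
  · have h1 : cdf ρ ⁻¹' Set.Iic u = Set.univ := by
      ext y; simp only [Set.mem_preimage, Set.mem_Iic, Set.mem_univ, iff_true]
      exact (cdf_le_one ρ y).trans hu1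
    rw [h1, measure_univ]
    symm
    refine le_antisymm prob_le_one ?_
    calc 1 = lam (Set.Iic 1) := by rw [lam_Iic zero_le_one le_rfl]; simp
      _ ≤ _ := measure_mono (Set.Iic_subset_Iic.2 hu1)

lemma cdf_inj : ∃ N : Set ℝ, MeasurableSet N ∧ ρ N = 0 ∧ Set.InjOn (cdf ρ) Nᶜ := by
  have hm := (cdf_cont ρ).measurable
  refine ⟨⋃ q : ℚ, cdf ρ ⁻¹' {cdf ρ q}, MeasurableSet.iUnion fun q => hm (measurableSet_singleton _),
    measure_iUnion_null fun q => ?_, ?_⟩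
  · rw [← Measure.map_apply hm (measurableSet_singleton _), cdf_map]; exact measure_singleton _
  · have key : ∀ x y, x ∈ (⋃ q : ℚ, cdf ρ ⁻¹' {cdf ρ q})ᶜ → x < y → cdf ρ x = cdf ρ y → False := by
      intro x y hx hxy he
      obtain ⟨q, h1, h2⟩ := exists_rat_btwn hxy
      apply hx
      refine Set.mem_iUnion.2 ⟨q, ?_⟩
      have a1 := monotone_cdf ρ h1.le
      have a2 := monotone_cdf ρ h2.le
      exact le_antisymm a1 (by rw [he]; exact a2)
    intro x hx y hy he
    rcases lt_trichotomy x y with h | h | h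
    · exact (key x y hx h he).elim
    · exact h
    · exact (key y x hy h he.symm).elim
end cdfsec

lemma compl_le_of {X : Type*} [MeasurableSpace X] (μ : Measure X) [IsProbabilityMeasure μ]
    {A : Set X} (hA : MeasurableSet A) {e : ENNReal} (h : 1 - e < μ A) : μ Aᶜ ≤ e := by
  rw [measure_compl hA (by finiteness), measure_univ, tsub_le_iff_left]
  exact tsub_le_iff_right.1 h.le

/-- A non-atomic law on a Polish space admits a uniform coordinate which is essentially a
homeomorphism on big compacts. -/
lemma polish_unif {Z : Type*} [TopologicalSpace Z] [PolishSpace Z] [MeasurableSpace Z]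
    [BorelSpace Z] (m : Measure Z) [IsProbabilityMeasure m] (hm : ∀ z, m {z} = 0) :
    ∃ θ : Z → ℝ, Measurable θ ∧ m.map θ = lam ∧ ∀ e : ENNReal, 0 < e → ∃ Q : Set Z, IsCompact Q ∧
      m Qᶜ ≤ e ∧ ContinuousOn θ Q ∧ Set.InjOn θ Q := by
  set g := embeddingReal Z
  have hg : MeasurableEmbedding g := measurableEmbedding_embeddingReal Z
  have hp : IsProbabilityMeasure (m.map g) := Measure.isProbabilityMeasure_map hg.measurable.aemeasurable
  have hna : NullSingletonClass (m.map g) := ⟨fun x => by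
    rw [Measure.map_apply hg.measurable (measurableSet_singleton x)]
    by_cases hx : ∃ z, g z = x
    · obtain ⟨z, rfl⟩ := hx
      convert hm z
      ext w; simp [hg.injective.eq_iff]
    · convert measure_empty (μ := m)
      ext w; simp only [Set.mem_preimage, Set.mem_singleton_iff, Set.mem_empty_iff_false, iff_false]
      exact fun h => hx ⟨w, h⟩⟩
  obtain ⟨N, hN, hN0, hinj⟩ := cdf_inj (m.map g)
  set G := ProbabilityTheory.cdf (m.map g)
  have hGm : Measurable G := (cdf_cont (m.map g)).measurable
  have hθ : Measurable (G ∘ g) := hGm.comp hg.measurable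
  refine ⟨G ∘ g, hθ, ?_, ?_⟩
  · rw [← Measure.map_map hGm hg.measurable, cdf_map]
  intro e he
  set B := (g ⁻¹' N)ᶜ
  have hB : MeasurableSet B := (hg.measurable hN).compl
  have hB1 : m Bᶜ = 0 := by
    rw [compl_compl, ← Measure.map_apply hg.measurable hN, hN0]
  have hBinj : Set.InjOn (G ∘ g) B := fun x hx y hy h => hg.injective (hinj hx hy h)
  set E : Set (Z × ℝ) := {p | p.1 ∈ B ∧ (G ∘ g) p.1 = p.2}
  have hE : MeasurableSet E :=
    (measurable_fst hB).inter (measurableSet_eq_fun (hθ.comp measurable_fst) measurable_snd)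
  have hγ : Measurable (fun z => (z, (G ∘ g) z)) := measurable_id.prodMk hθ
  set τ := m.map (fun z => (z, (G ∘ g) z))
  have hτ : IsProbabilityMeasure τ := Measure.isProbabilityMeasure_map hγ.aemeasurable
  have hτE : τ E = 1 := by
    rw [Measure.map_apply hγ hE]
    have : (fun z => (z, (G ∘ g) z)) ⁻¹' E = B := by ext z; simp [E]
    rw [this]
    exact (prob_compl_eq_zero_iff hB).1 hB1
  obtain ⟨C, hCE, hC, hCe⟩ := hE.exists_lt_isCompact_of_ne_top (μ := τ) (by finiteness)
    (r := 1 - e) (by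
      rw [hτE]; exact ENNReal.sub_lt_self (by simp) (by simp) he.ne')
  have hQ : IsCompact (Prod.fst '' C) := hC.image continuous_fst
  refine ⟨Prod.fst '' C, hQ, ?_, ?_, ?_⟩
  · apply compl_le_of m hQ.isClosed.measurableSet
    refine hCe.trans_le ?_
    rw [Measure.map_apply hγ hC.isClosed.measurableSet]
    exact measure_mono fun z hz => ⟨_, hz, rfl⟩
  · rw [continuousOn_iff_isClosed]
    intro t ht
    refine ⟨Prod.fst '' (C ∩ Prod.snd ⁻¹' t), ?_, ?_⟩
    · exact ((hC.inter_right (ht.preimage continuous_snd)).image continuous_fst).isClosed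
    · ext z
      constructor
      · rintro ⟨h1, p, hp, rfl⟩
        refine ⟨⟨p, ⟨hp, ?_⟩, rfl⟩, p, hp, rfl⟩
        change p.2 ∈ t
        rw [← (hCE hp).2]; exact h1
      · rintro ⟨⟨p, ⟨hp, hpt⟩, rfl⟩, h2⟩
        refine ⟨?_, h2⟩
        change (G ∘ g) p.1 ∈ t
        rw [(hCE hp).2]; exact hpt
  · refine hBinj.mono ?_
    rintro _ ⟨p, hp, rfl⟩
    exact (hCE hp).1

lemma exists_sep {X : Type*} [TopologicalSpace X] [CompletelyRegularSpace X] {x y : X}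
    (h : ¬ Inseparable x y) : ∃ f : C(X, ℝ), f x ≠ f y := by
  rw [inseparable_iff_forall_isClosed] at h
  push Not at h
  obtain ⟨S, hS, hxy⟩ := h
  have key : ∀ a b : X, a ∈ S → b ∉ S → ∃ f : C(X, ℝ), f a ≠ f b := by
    intro a b ha hb
    obtain ⟨f, hf, h0, h1⟩ := CompletelyRegularSpace.completely_regular b S hS hb
    refine ⟨⟨fun x => (f x : ℝ), continuous_subtype_val.comp hf⟩, ?_⟩
    simp [h0, h1 ha]
  rcases hxy with ⟨h1, h2⟩ | ⟨h1, h2⟩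
  · exact key x y h1 h2
  · obtain ⟨f, hf⟩ := key y x h2 h1; exact ⟨f, hf.symm⟩

lemma lemmaB0 {X : Type*} [TopologicalSpace X] [CompletelyRegularSpace X]
    (K : ℕ → Set X) (hK : ∀ n, IsCompact (K n))
    (hKm : ∀ n, TopologicalSpace.MetrizableSpace (K n)) :
    ∃ F : X → (ℕ → ℝ), Continuous F ∧ ∀ x ∈ ⋃ n, closure (K n), ∀ y ∈ ⋃ n, closure (K n),
      F x = F y → Inseparable x y := by
  have hT : ∀ n m, ∃ S : Set C(X, ℝ), S.Countable ∧ ∀ x ∈ K n, ∀ y ∈ K m,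
      (∀ f ∈ S, f x = f y) → Inseparable x y := by
    intro n m
    have := hKm n
    have := hKm m
    have : CompactSpace (K n) := isCompact_iff_compactSpace.1 (hK n)
    have : CompactSpace (K m) := isCompact_iff_compactSpace.1 (hK m)
    have : SecondCountableTopology (K n) := by
      letI := TopologicalSpace.metrizableSpaceMetric (K n); infer_instance
    have : SecondCountableTopology (K m) := by
      letI := TopologicalSpace.metrizableSpaceMetric (K m); infer_instance
    obtain ⟨S, hS, hSU⟩ := TopologicalSpace.isOpen_iUnion_countable
      (fun f : C(X, ℝ) => {p : K n × K m | f p.1 ≠ f p.2}) (fun f => by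
        apply isOpen_ne_fun <;> fun_prop)
    refine ⟨S, hS, fun x hx y hy h => ?_⟩
    by_contra hcon
    obtain ⟨f, hf⟩ := exists_sep hcon
    have h1 : ((⟨x, hx⟩, ⟨y, hy⟩) : K n × K m) ∈ ⋃ f : C(X, ℝ), {p : K n × K m | f p.1 ≠ f p.2} :=
      Set.mem_iUnion.2 ⟨f, hf⟩
    rw [← hSU] at h1
    obtain ⟨g, hg, h2⟩ := Set.mem_iUnion₂.1 h1
    exact h2 (h g hg)
  choose S hS hSep using hT
  have hc : (insert (0 : C(X, ℝ)) (⋃ n, ⋃ m, S n m)).Countable :=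
    (Set.countable_iUnion fun n => Set.countable_iUnion fun m => hS n m).insert _
  obtain ⟨e, he⟩ := hc.exists_eq_range (Set.insert_nonempty _ _)
  have hFc : Continuous fun x k => e k x := continuous_pi fun k => (e k).continuous
  refine ⟨fun x k => e k x, hFc, ?_⟩
  intro x hx y hy h
  obtain ⟨n, hx⟩ := Set.mem_iUnion.1 hx
  obtain ⟨m, hy⟩ := Set.mem_iUnion.1 hy
  rw [(hK n).closure_eq_biUnion_inseparable] at hx
  rw [(hK m).closure_eq_biUnion_inseparable] at hy
  obtain ⟨x', hx', hxx⟩ := Set.mem_iUnion₂.1 hx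
  obtain ⟨y', hy', hyy⟩ := Set.mem_iUnion₂.1 hy
  have hxx : Inseparable x' x := hxx
  have hyy : Inseparable y' y := hyy
  refine hxx.symm.trans ((hSep n m x' hx' y' hy' fun f hf => ?_).trans hyy)
  have hf2 : f ∈ insert (0 : C(X, ℝ)) (⋃ n, ⋃ m, S n m) :=
    Set.mem_insert_of_mem _ (Set.mem_iUnion₂.2 ⟨n, m, hf⟩)
  rw [he] at hf2
  obtain ⟨k, rfl⟩ := hf2
  rw [(hxx.map (e k).continuous).eq, (hyy.map (e k).continuous).eq]
  exact congrFun h k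

lemma lemmaB {X : Type*} [TopologicalSpace X] [CompletelyRegularSpace X] [MeasurableSpace X]
    [BorelSpace X] (μ : Measure X) [IsProbabilityMeasure μ] (hna : ∀ x, μ {x} = 0)
    (hconc : ∃ K : ℕ → Set X, (∀ n, IsCompact (K n)) ∧
      (∀ n, TopologicalSpace.MetrizableSpace (K n)) ∧ μ (⋃ n, K n) = 1) :
    ∃ φ : X → ℝ, Measurable φ ∧ μ.map φ = lam ∧ ∀ e : ENNReal, 0 < e → ∃ K : Set X,
      IsCompact K ∧ MeasurableSet K ∧ ContinuousOn φ K ∧ μ Kᶜ ≤ e ∧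
      ∀ x ∈ K, ∀ y ∈ K, φ x = φ y → Inseparable x y := by
  obtain ⟨K, hK, hKm, hK1⟩ := hconc
  obtain ⟨F, hF, hsep⟩ := lemmaB0 K hK hKm
  set L := ⋃ n, closure (K n) with hL
  have hLm : MeasurableSet L := MeasurableSet.iUnion fun n => isClosed_closure.measurableSet
  have hL1 : μ L = 1 := le_antisymm prob_le_one
    (hK1 ▸ measure_mono (Set.iUnion_mono fun n => subset_closure))
  have hL0 : μ Lᶜ = 0 := (prob_compl_eq_zero_iff hLm).2 hL1
  have hFm := hF.measurable
  have hmp : IsProbabilityMeasure (μ.map F) := Measure.isProbabilityMeasure_map hFm.aemeasurable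
  have hins : ∀ x, μ {y | Inseparable x y} = 0 := by
    intro x
    refine measure_mono_null (t := toMeasurable μ {x}) ?_ (by rw [measure_toMeasurable, hna])
    intro y hy
    have hy : Inseparable x y := hy
    exact (hy.mem_measurableSet_iff (measurableSet_toMeasurable μ {x})).1
      (subset_toMeasurable μ {x} rfl)
  obtain ⟨θ, hθ, hθl, hθK⟩ := polish_unif (μ.map F) (by
    intro z
    rw [Measure.map_apply hFm (measurableSet_singleton z)]
    by_cases hz : ∃ x ∈ L, F x = z
    · obtain ⟨x, hx, rfl⟩ := hz
      refine measure_mono_null (t := {y | Inseparable x y} ∪ Lᶜ) ?_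
        (measure_union_null (hins x) hL0)
      intro y hy
      by_cases hyL : y ∈ L
      · left; exact hsep x hx y hyL hy.symm
      · right; exact hyL
    · refine measure_mono_null ?_ hL0
      intro y hy hyL; exact hz ⟨y, hyL, hy⟩)
  refine ⟨θ ∘ F, hθ.comp hFm, by rw [← Measure.map_map hθ hFm, hθl], fun e he => ?_⟩
  have he2 : 0 < e / 2 := ENNReal.half_pos he.ne'
  obtain ⟨Q, hQ, hQe, hQc, hQi⟩ := hθK (e / 2) he2
  have hQm : MeasurableSet (F ⁻¹' Q) := hFm hQ.isClosed.measurableSet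
  have hlim := tendsto_measure_iUnion_accumulate (μ := μ) (f := fun n => closure (K n))
  rw [← hL, hL1] at hlim
  obtain ⟨N, hN⟩ := (hlim.eventually (lt_mem_nhds (a := 1 - e / 2)
    (ENNReal.sub_lt_self (by simp) (by simp) he2.ne'))).exists
  set A := Set.accumulate (fun n => closure (K n)) N with hA
  have hAc : IsCompact A := by
    rw [hA, Set.accumulate_def]
    exact (Set.finite_Iic N).isCompact_biUnion fun n _ => (hK n).closure
  have hAcl : IsClosed A := by
    rw [hA, Set.accumulate_def]
    exact (Set.finite_Iic N).isClosed_biUnion fun n _ => isClosed_closure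
  have hAL : A ⊆ L := Set.accumulate_subset_iUnion N
  refine ⟨A ∩ F ⁻¹' Q, hAc.inter_right (hQ.isClosed.preimage hF), hAcl.measurableSet.inter hQm,
    hQc.comp hF.continuousOn fun x hx => hx.2, ?_, ?_⟩
  · rw [Set.compl_inter]
    calc _ ≤ μ Aᶜ + μ (F ⁻¹' Q)ᶜ := measure_union_le _ _
      _ ≤ e / 2 + e / 2 := by
          gcongr
          · exact compl_le_of μ hAcl.measurableSet hN
          · rw [← Set.preimage_compl, ← Measure.map_apply hFm hQ.isClosed.measurableSet.compl]
            exact hQe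
      _ = e := ENNReal.add_halves e
  · intro x hx y hy h
    exact hsep x (hAL hx.1) y (hAL hy.1) (hQi hx.2 hy.2 h)

/-- modulus -/
lemma modulus {X : Type*} [TopologicalSpace X] {K : Set X} (hK : IsCompact K) {φ : X → ℝ}
    (hφ : ContinuousOn φ K) (hi : ∀ x ∈ K, ∀ y ∈ K, φ x = φ y → Inseparable x y)
    {Z : Type*} [MetricSpace Z] {f : X → Z} (hf : Continuous f) {e : ℝ} (he : 0 < e) :
    ∃ δ > 0, ∀ x ∈ K, ∀ y ∈ K, |φ x - φ y| ≤ δ → dist (f x) (f y) < e := by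
  have hg : ContinuousOn (fun p : X × X => |φ p.1 - φ p.2|) (K ×ˢ K) :=
    ((hφ.comp continuousOn_fst fun p hp => hp.1).sub
      (hφ.comp continuousOn_snd fun p hp => hp.2)).abs
  set S := (K ×ˢ K) ∩ {p : X × X | e ≤ dist (f p.1) (f p.2)}
  have hS : IsCompact S := (hK.prod hK).inter_right (isClosed_le continuous_const (by fun_prop))
  rcases S.eq_empty_or_nonempty with h0 | hne
  · refine ⟨1, one_pos, fun x hx y hy _ => ?_⟩
    by_contra hcon
    have : (x, y) ∈ S := ⟨⟨hx, hy⟩, not_lt.1 hcon⟩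
    rw [h0] at this; exact this
  · obtain ⟨p, hp, hmin⟩ := hS.exists_isMinOn hne (hg.mono Set.inter_subset_left)
    have hpos : 0 < |φ p.1 - φ p.2| := by
      rw [abs_pos, sub_ne_zero]
      intro h
      have := (hi _ hp.1.1 _ hp.1.2 h).map hf
      have h2 : e ≤ dist (f p.1) (f p.2) := hp.2
      rw [this.eq, dist_self] at h2
      linarith
    refine ⟨|φ p.1 - φ p.2| / 2, by positivity, fun x hx y hy h => ?_⟩
    by_contra hcon
    have := hmin (show (x, y) ∈ S from ⟨⟨hx, hy⟩, not_lt.1 hcon⟩)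
    have h3 : |φ p.1 - φ p.2| ≤ |φ x - φ y| := this
    linarith

open ProbabilityTheory in
lemma lift_cop {Y : Type*} [MeasurableSpace Y] (ρ : Measure (ℝ × Y)) [IsProbabilityMeasure ρ]
    {ξ : ℝ → Y} (hξ : Measurable ξ) (h1 : ρ.map Prod.fst = lam)
    (h2 : ρ.map Prod.snd = lam.map ξ) :
    ∃ π : Measure (ℝ × ℝ), IsCop π ∧ π.map (Prod.map id ξ) = ρ := by
  set ρ' := ρ.map Prod.swap with hρ'
  have hp' : IsProbabilityMeasure ρ' := Measure.isProbabilityMeasure_map measurable_swap.aemeasurable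
  have hfst : ρ'.fst = lam.map ξ := by
    rw [Measure.fst, hρ', Measure.map_map measurable_fst measurable_swap, ← h2]; rfl
  set κ := ρ'.condKernel
  have hdis : ρ'.fst ⊗ₘ κ = ρ' := ρ'.disintegrate κ
  set π' := lam ⊗ₘ (κ.comap ξ hξ) with hπ'
  have hx : Measurable (Prod.map ξ (id : ℝ → ℝ)) := hξ.prodMap measurable_id
  have hmap : π'.map (Prod.map ξ id) = ρ' := by
    ext s hs
    rw [Measure.map_apply hx hs, hπ', Measure.compProd_apply (hx hs), ← hdis,
      Measure.compProd_apply hs, hfst, lintegral_map (Kernel.measurable_kernel_prodMk_left hs) hξ]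
    rfl
  have hπfst : π'.map Prod.fst = lam := by
    have : π'.fst = lam := Measure.fst_compProd _ _
    exact this
  have hπsnd : π'.map Prod.snd = lam := by
    have : π'.map Prod.snd = (π'.map (Prod.map ξ id)).map Prod.snd := by
      rw [Measure.map_map measurable_snd hx]; rfl
    rw [this, hmap, hρ', Measure.map_map measurable_snd measurable_swap, ← h1]; rfl
  refine ⟨π'.map Prod.swap, ⟨?_, ?_⟩, ?_⟩
  · rw [Measure.map_map measurable_fst measurable_swap, ← hπsnd]; rfl
  · rw [Measure.map_map measurable_snd measurable_swap, ← hπfst]; rfl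
  · rw [Measure.map_map (measurable_id.prodMap hξ) measurable_swap]
    have : ρ = ρ'.map Prod.swap := by
      rw [hρ', Measure.map_map measurable_swap measurable_swap]; simp
    rw [this, ← hmap, Measure.map_map measurable_swap hx]; rfl

lemma D_exists {X Y : Type*} [TopologicalSpace X] [MetricSpace Y] [MeasurableSpace Y] [BorelSpace Y]
    {φ : X → ℝ} {K : Set X} (hK : IsCompact K) (hφK : ContinuousOn φ K)
    (hi : ∀ x ∈ K, ∀ y ∈ K, φ x = φ y → Inseparable x y)
    {c : X → Y → ℝ} (hc : Continuous fun p : X × Y => c p.1 p.2) :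
    ∃ D : ℝ × Y → ENNReal, Measurable D ∧ (∀ x ∈ K, ∀ y, D (φ x, y) = ENNReal.ofReal (c x y)) ∧
      ∀ u ∉ φ '' K, ∀ y, D (u, y) = 0 := by
  classical
  have hS : MeasurableSet (φ '' K) := (hK.image_of_continuousOn hφK).isClosed.measurableSet
  have hψ : ∀ u : φ '' K, ∃ x ∈ K, φ x = u := fun u => u.2
  choose ψ hψK hψφ using hψ
  set q : (φ '' K) → Y → ENNReal := fun u y => ENNReal.ofReal (c (ψ u) y)
  have hq : Measurable (Function.uncurry q) := by
    refine measurable_uncurry_of_continuous_of_measurable (u := q) (fun y => ?_) (fun u => ?_)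
    · refine ENNReal.continuous_ofReal.comp ?_
      rw [continuous_iff_continuousAt]
      intro u
      refine Metric.tendsto_nhds.2 fun e he => ?_
      obtain ⟨δ, hδ, hmod⟩ := modulus hK hφK hi (f := fun x => c x y)
        (hc.comp (by fun_prop : Continuous fun x => (x, y))) he
      filter_upwards [Metric.ball_mem_nhds u hδ] with u' hu'
      refine hmod _ (hψK _) _ (hψK _) ?_
      rw [hψφ, hψφ, ← Real.dist_eq]
      exact (Metric.mem_ball.1 hu').le
    · exact (ENNReal.continuous_ofReal.comp (hc.comp (by fun_prop : Continuous fun y => (ψ u, y)))).measurable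
  have hemb : MeasurableEmbedding (Prod.map (Subtype.val : φ '' K → ℝ) (id : Y → Y)) :=
    (MeasurableEmbedding.subtype_coe hS).prodMap MeasurableEmbedding.id
  refine ⟨Function.extend (Prod.map (Subtype.val : φ '' K → ℝ) (id : Y → Y))
    (Function.uncurry q) 0, hemb.measurable_extend hq measurable_const, ?_, ?_⟩
  · intro x hx y
    have := hemb.injective.extend_apply (Function.uncurry q) 0 (⟨φ x, x, hx, rfl⟩, y)
    refine this.trans ?_
    change ENNReal.ofReal (c (ψ _) y) = _
    have h1 := hi _ (hψK ⟨φ x, x, hx, rfl⟩) _ hx (hψφ _)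
    have := (h1.map (hc.comp (by fun_prop : Continuous fun x => (x, y)))).eq
    exact congrArg _ this
  · intro u hu y
    rw [Function.extend_apply']
    · rfl
    · rintro ⟨⟨a, b⟩, hab⟩
      apply hu
      have : a.1 = u := congrArg Prod.fst hab
      rw [← this]; exact a.2

section loc
variable {X Y T : Type*} [TopologicalSpace X] [MeasurableSpace X] [MetricSpace Y]
  [MeasurableSpace Y] [BorelSpace Y] [MetricSpace T]
  (μ : Measure X) (ν : T → Measure Y) (φ : X → ℝ) (K : Set X) (ξ : T → ℝ → Y)
  (c h : X → Y → T → ℝ) (E : ENNReal)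

/-- good pairs -/
def Good (t : T) (δ : ℝ) (π : Measure (ℝ × ℝ)) : Prop :=
  ∃ g : ℝ × ℝ → ENNReal, Measurable g ∧
    (∀ x ∈ K, ∀ u v, |φ x - u| ≤ δ → ENNReal.ofReal (c x (ξ t v) t) ≤ g (u, v)) ∧
    ∫⁻ p, g p ∂π ≤ kantorovichCost (fun x y => h x y t) μ (ν t) + E

lemma Good.mono {t : T} {δ δ' : ℝ} {π : Measure (ℝ × ℝ)} (hδ : δ' ≤ δ)
    (hG : Good μ ν φ K ξ c h E t δ π) : Good μ ν φ K ξ c h E t δ' π := by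
  obtain ⟨g, h1, h2, h3⟩ := hG
  exact ⟨g, h1, fun x hx u v huv => h2 x hx u v (huv.trans hδ), h3⟩

lemma Good.convex {t : T} {δ : ℝ} {π₁ π₂ : Measure (ℝ × ℝ)} {a b : ℝ} (ha : 0 ≤ a) (hb : 0 ≤ b)
    (hab : a + b = 1)
    (h₁ : Good μ ν φ K ξ c h E t δ π₁) (h₂ : Good μ ν φ K ξ c h E t δ π₂) :
    Good μ ν φ K ξ c h E t δ (ENNReal.ofReal a • π₁ + ENNReal.ofReal b • π₂) := by
  obtain ⟨g₁, m1, b1, c1⟩ := h₁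
  obtain ⟨g₂, m2, b2, c2⟩ := h₂
  refine ⟨fun p => min (g₁ p) (g₂ p), m1.min m2,
    fun x hx u v huv => le_min (b1 x hx u v huv) (b2 x hx u v huv), ?_⟩
  set k := kantorovichCost (fun x y => h x y t) μ (ν t) + E
  rw [lintegral_add_measure, lintegral_smul_measure, lintegral_smul_measure, smul_eq_mul, smul_eq_mul]
  calc _ ≤ ENNReal.ofReal a * k + ENNReal.ofReal b * k := by
        gcongr
        · exact (lintegral_mono fun p => min_le_left _ _).trans c1
        · exact (lintegral_mono fun p => min_le_right _ _).trans c2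
    _ = k := by rw [← add_mul, ← ENNReal.ofReal_add ha hb, hab]; simp

variable [IsProbabilityMeasure μ] 

omit [MetricSpace T] [BorelSpace Y] [MetricSpace Y] [TopologicalSpace X] in
lemma lower_bd {ν : Measure Y} {ξ : ℝ → Y} {c h : X → Y → ℝ}
    (hφm : Measurable φ) (hφl : μ.map φ = lam) (hKm : MeasurableSet K)
    (hξm : Measurable ξ) (hξl : lam.map ξ = ν)
    (M : ℝ) (hcM : ∀ x y, c x y ≤ M) (hch : ∀ x y, c x y ≤ h x y) 
    {D : ℝ × Y → ENNReal} (hD : Measurable D)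
    (hDK : ∀ x ∈ K, ∀ y, D (φ x, y) = ENNReal.ofReal (c x y))
    (hDn : ∀ u ∉ φ '' K, ∀ y, D (u, y) = 0) (σ : Measure (X × Y)) (hσ : IsCoupling σ μ ν) :
    ∃ π, IsCop π ∧ ∫⁻ p, D (p.1, ξ p.2) ∂π ≤
      ∫⁻ p, ENNReal.ofReal (h p.1 p.2) ∂σ + ENNReal.ofReal M * μ Kᶜ := by
  have hσp : IsProbabilityMeasure σ := by
    have : IsProbabilityMeasure (σ.map Prod.fst) := by rw [hσ.1]; infer_instance
    exact Measure.isProbabilityMeasure_of_map (f := Prod.fst)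
  have hm : Measurable (Prod.map φ (id : Y → Y)) := hφm.prodMap measurable_id
  have : IsProbabilityMeasure (σ.map (Prod.map φ (id : Y → Y))) :=
    Measure.isProbabilityMeasure_map hm.aemeasurable
  obtain ⟨π, hπ, hπe⟩ := lift_cop (σ.map (Prod.map φ (id : Y → Y))) hξm
    (by
      rw [Measure.map_map measurable_fst hm, ← hφl, ← hσ.1, Measure.map_map hφm measurable_fst]; rfl)
    (by rw [Measure.map_map measurable_snd hm, hξl, ← hσ.2]; rfl)
  refine ⟨π, hπ, ?_⟩
  have e1 : ∫⁻ p, D (p.1, ξ p.2) ∂π = ∫⁻ p, D (φ p.1, p.2) ∂σ := by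
    have a1 := lintegral_map (μ := π) hD (measurable_id.prodMap hξm)
    have a2 := lintegral_map (μ := σ) hD hm
    rw [hπe] at a1
    exact a1.symm.trans a2
  rw [e1]
  have hDM : ∀ u y, D (u, y) ≤ ENNReal.ofReal M := by
    intro u y
    by_cases hu : u ∈ φ '' K
    · obtain ⟨x, hx, rfl⟩ := hu
      rw [hDK x hx]; exact ENNReal.ofReal_le_ofReal (hcM _ _)
    · rw [hDn u hu]; exact zero_le
  calc _ ≤ ∫⁻ p, (ENNReal.ofReal (h p.1 p.2) +
        (Prod.fst ⁻¹' Kᶜ).indicator (fun _ => ENNReal.ofReal M) p) ∂σ := by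
        refine lintegral_mono fun p => ?_
        by_cases hp : p.1 ∈ K
        · rw [hDK _ hp]
          exact (ENNReal.ofReal_le_ofReal (hch _ _)).trans le_self_add
        · rw [Set.indicator_of_mem (by exact hp)]
          exact (hDM _ _).trans le_add_self
    _ = _ := by
        have hms : MeasurableSet ((Prod.fst : X × Y → X) ⁻¹' Kᶜ) := measurable_fst hKm.compl
        rw [lintegral_add_right _ (measurable_const.indicator hms), lintegral_indicator_const hms,
          ← Measure.map_apply measurable_fst hKm.compl, hσ.1]

lemma local_V (hK : IsCompact K) (hφK : ContinuousOn φ K)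
    (hi : ∀ x ∈ K, ∀ y ∈ K, φ x = φ y → Inseparable x y)
    (hc : Continuous fun p : X × Y × T => c p.1 p.2.1 p.2.2) (t₀ : T)
    (hξc : ∀ᵐ v ∂lam, ContinuousAt (fun p : T × ℝ => ξ p.1 p.2) (t₀, v)) {η : ℝ} (hη : 0 < η) :
    ∃ r > 0, ∃ V : Set ℝ, MeasurableSet V ∧ lam Vᶜ ≤ ENNReal.ofReal η ∧
      ∀ v ∈ V, ∀ t ∈ Metric.ball t₀ r, ∀ x ∈ K, ∀ x' ∈ K, |φ x - φ x'| ≤ r →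
        |c x (ξ t v) t - c x' (ξ t₀ v) t₀| ≤ η := by
  set A : ℕ → Set ℝ := fun n => {v | ∀ t ∈ Metric.ball t₀ (1 / ((n:ℝ) + 1)), ∀ x ∈ K, ∀ x' ∈ K,
    |φ x - φ x'| ≤ 1 / ((n:ℝ) + 1) → |c x (ξ t v) t - c x' (ξ t₀ v) t₀| ≤ η} with hA
  have hAmono : Monotone A := by
    intro n m hnm v hv t ht x hx x' hx' hd
    have := one_div_le_one_div_of_le (by positivity : (0:ℝ) < n + 1)
      (by gcongr : (n:ℝ) + 1 ≤ m + 1)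
    exact hv t (Metric.ball_subset_ball this ht) x hx x' hx' (hd.trans this)
  have hVmono : Monotone fun n => interior (A n) := fun n m h => interior_mono (hAmono h)
  have hae : ∀ᵐ v ∂lam, v ∈ ⋃ n, interior (A n) := by
    filter_upwards [hξc] with v hv
    have h1 : ∀ᶠ z : Y × T in 𝓝 (ξ t₀ v, t₀), ∀ x ∈ K,
        |c x z.1 z.2 - c x (ξ t₀ v) t₀| < η / 3 := by
      refine hK.eventually_forall_of_forall_eventually
        (P := fun (z : Y × T) x => |c x z.1 z.2 - c x (ξ t₀ v) t₀| < η / 3) fun x _ => ?_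
      have hcc : Continuous fun w : (Y × T) × X =>
          |c w.2 w.1.1 w.1.2 - c w.2 (ξ t₀ v) t₀| := by
        refine ((hc.comp (by fun_prop : Continuous fun w : (Y × T) × X => (w.2, w.1.1, w.1.2))).sub
          (hc.comp (by fun_prop : Continuous fun w : (Y × T) × X => (w.2, ξ t₀ v, t₀)))).abs
      exact hcc.continuousAt.eventually_lt_const (by simpa using hη)
    obtain ⟨δ, hδ, hmod⟩ := modulus hK hφK hi (f := fun x => c x (ξ t₀ v) t₀)
      (hc.comp (by fun_prop : Continuous fun x => (x, ξ t₀ v, t₀))) (e := η / 3) (by positivity)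
    have h2 : ContinuousAt (fun p : T × ℝ => (ξ p.1 p.2, p.1)) (t₀, v) :=
      hv.prodMk continuousAt_fst
    have h3 := h2.eventually h1
    rw [nhds_prod_eq] at h3
    obtain ⟨P, hP, Q, hQ, hPQ⟩ := eventually_prod_iff.1 h3
    obtain ⟨r, hr, hrP⟩ := Metric.eventually_nhds_iff_ball.1 hP
    obtain ⟨n, hn⟩ := exists_nat_one_div_lt (show 0 < min r δ from lt_min hr hδ)
    refine Set.mem_iUnion.2 ⟨n, mem_interior_iff_mem_nhds.2 ?_⟩
    filter_upwards [hQ] with v' hv' t ht x hx x' hx' hd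
    have a1 := hPQ (hrP t (Metric.ball_subset_ball (hn.le.trans (min_le_left _ _)) ht)) hv' x hx
    have a2 := hPQ (hrP t₀ (Metric.mem_ball_self hr)) hv' x' hx'
    have a3 := hmod x hx x' hx' (hd.trans (hn.le.trans (min_le_right _ _)))
    rw [Real.dist_eq] at a3
    simp only at a1 a2
    rw [abs_lt] at a1 a2 a3
    rw [abs_le]
    constructor <;> linarith
  have hU : lam (⋃ n, interior (A n)) = 1 := by
    rw [← prob_compl_eq_zero_iff (isOpen_iUnion fun n => isOpen_interior).measurableSet]
    exact hae
  have hlim := tendsto_measure_iUnion_atTop (μ := lam) hVmono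
  rw [hU] at hlim
  have hη' : 0 < ENNReal.ofReal η := by simpa using hη
  obtain ⟨n, hn⟩ := (hlim.eventually (lt_mem_nhds (a := 1 - ENNReal.ofReal η)
    (ENNReal.sub_lt_self (by simp) (by simp) hη'.ne'))).exists
  refine ⟨1 / ((n:ℝ) + 1), by positivity, interior (A n), isOpen_interior.measurableSet,
    compl_le_of lam isOpen_interior.measurableSet hn, ?_⟩
  intro v hv t ht x hx x' hx' hd
  exact interior_subset hv t ht x hx x' hx' hd

lemma local_good (hφm : Measurable φ) (hφl : μ.map φ = lam)
    (hK : IsCompact K) (hKm : MeasurableSet K) (hφK : ContinuousOn φ K)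
    (hi : ∀ x ∈ K, ∀ y ∈ K, φ x = φ y → Inseparable x y)
    (hξm : ∀ t, Measurable (ξ t)) (hξl : ∀ t, lam.map (ξ t) = ν t)
    (hc : Continuous fun p : X × Y × T => c p.1 p.2.1 p.2.2)
    (hc0 : ∀ x y t, 0 ≤ c x y t)
    (M : ℝ) (hcM : ∀ x y t, c x y t ≤ M) (hch : ∀ x y t, c x y t ≤ h x y t) (t₀ : T)
    (hξc : ∀ᵐ v ∂lam, ContinuousAt (fun p : T × ℝ => ξ p.1 p.2) (t₀, v)) {η : ℝ} (hη : 0 < η)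
    (hKη : μ Kᶜ ≤ ENNReal.ofReal η) :
    ∃ δ > 0, ∃ π, IsCop π ∧ ∀ᶠ t in 𝓝 t₀, Good μ ν φ K ξ c h
      (3 * ENNReal.ofReal η + 4 * ENNReal.ofReal M * ENNReal.ofReal η) t δ π := by
  obtain ⟨r, hr, V, hVm, hV, hVc⟩ := local_V φ K ξ c hK hφK hi hc t₀ hξc hη
  have hDex := fun t => D_exists (c := fun x y => c x y t) hK hφK hi
    (hc.comp (by fun_prop : Continuous fun p : X × Y => (p.1, p.2, t)))
  choose D hD hDK hDn using hDex
  have hS : MeasurableSet (φ '' K) := (hK.image_of_continuousOn hφK).isClosed.measurableSet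
  set m := ENNReal.ofReal M
  set e := ENNReal.ofReal η with he
  have he0 : e ≠ 0 := by simpa [e] using hη
  set C : ℝ × ℝ → ENNReal := fun p => D t₀ (p.1, ξ t₀ p.2)
  have hC : Measurable C := (hD t₀).comp (measurable_fst.prodMk ((hξm t₀).comp measurable_snd))
  have hCM : ∀ p, C p ≤ m := by
    rintro ⟨u, v⟩
    by_cases hu : u ∈ φ '' K
    · obtain ⟨x, hx, rfl⟩ := hu
      simp only [C]; rw [hDK t₀ x hx]; exact ENNReal.ofReal_le_ofReal (hcM _ _ _)
    · simp only [C]; rw [hDn t₀ u hu]; exact zero_le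
  set k := ⨅ (π : Measure (ℝ × ℝ)) (_ : IsCop π), ∫⁻ p, C p ∂π with hk
  have hcop0 : IsCop (lam.prod lam) := ⟨by simp, by simp⟩
  have hkfin : k ≠ ⊤ := by
    refine ne_top_of_le_ne_top (b := m) (by simp [m]) ?_
    refine (iInf₂_le _ hcop0).trans ((lintegral_mono hCM).trans ?_)
    simp
  obtain ⟨π₀, hπ₀, hπ₀k⟩ : ∃ π, IsCop π ∧ ∫⁻ p, C p ∂π ≤ k + e := by
    have : k < k + e := ENNReal.lt_add_right hkfin he0
    conv at this => lhs; rw [hk]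
    obtain ⟨π, hπ⟩ := iInf_lt_iff.1 this
    obtain ⟨hπc, hπ⟩ := iInf_lt_iff.1 hπ
    exact ⟨π, hπc, hπ.le⟩
  refine ⟨r, hr, π₀, hπ₀, ?_⟩
  filter_upwards [Metric.ball_mem_nhds t₀ hr] with t ht
  have hVi : Measurable fun p : ℝ × ℝ => (Prod.snd ⁻¹' Vᶜ).indicator (fun _ => m) p :=
    measurable_const.indicator (measurable_snd hVm.compl)
  have hSi : Measurable fun p : ℝ × ℝ => (Prod.fst ⁻¹' (φ '' K)ᶜ).indicator (fun _ => m) p :=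
    measurable_const.indicator (measurable_fst hS.compl)
  have hVint : ∀ π, IsCop π → ∫⁻ p, (Prod.snd ⁻¹' Vᶜ).indicator (fun _ => m) p ∂π ≤ m * e := by
    intro π hπ
    rw [lintegral_indicator_const (measurable_snd hVm.compl),
      ← Measure.map_apply measurable_snd hVm.compl, hπ.2]
    gcongr
  have hSint : ∀ π, IsCop π →
      ∫⁻ p, (Prod.fst ⁻¹' (φ '' K)ᶜ).indicator (fun _ => m) p ∂π ≤ m * e := by
    intro π hπ
    rw [lintegral_indicator_const (measurable_fst hS.compl),
      ← Measure.map_apply measurable_fst hS.compl, hπ.1, ← hφl, Measure.map_apply hφm hS.compl]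
    gcongr
    refine le_trans (measure_mono ?_) hKη
    intro x hx hxK
    exact hx ⟨x, hxK, rfl⟩
  refine ⟨fun p => ((C p + e) + (Prod.snd ⁻¹' Vᶜ).indicator (fun _ => m) p) +
    (Prod.fst ⁻¹' (φ '' K)ᶜ).indicator (fun _ => m) p,
    ((hC.add_const e).add hVi).add hSi, ?_, ?_⟩
  · intro x hx u v huv
    beta_reduce
    by_cases hu : u ∈ φ '' K
    swap
    · have : (Prod.fst ⁻¹' (φ '' K)ᶜ).indicator (fun _ => m) (u, v) = m :=
        Set.indicator_of_mem (by exact hu) _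
      rw [this]
      exact (ENNReal.ofReal_le_ofReal (hcM _ _ _)).trans le_add_self
    by_cases hv : v ∈ V
    swap
    · have : (Prod.snd ⁻¹' Vᶜ).indicator (fun _ => m) (u, v) = m :=
        Set.indicator_of_mem (by exact hv) _
      rw [this]
      exact ((ENNReal.ofReal_le_ofReal (hcM _ _ _)).trans le_add_self).trans le_self_add
    obtain ⟨x', hx', rfl⟩ := hu
    refine le_trans ?_ (le_self_add.trans le_self_add)
    simp only [C]
    rw [hDK t₀ x' hx', he, ← ENNReal.ofReal_add (hc0 _ _ _) hη.le]
    apply ENNReal.ofReal_le_ofReal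
    have := (abs_le.1 (hVc v hv t ht x hx x' hx' huv)).2
    linarith
  · have : IsProbabilityMeasure π₀ := hπ₀.prob
    rw [lintegral_add_right _ hSi, lintegral_add_right _ hVi, lintegral_add_right _ measurable_const,
      lintegral_const, measure_univ, mul_one]
    have hlow : k ≤ kantorovichCost (fun x y => h x y t) μ (ν t) + (e + 2 * m * e) := by
      unfold kantorovichCost
      simp only [ENNReal.iInf_add]
      refine le_iInf₂ fun σ hσ => ?_
      obtain ⟨π, hπ, hle⟩ := lower_bd μ φ K hφm hφl hKm (hξm t) (hξl t) M (fun x y => hcM x y t)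
        (fun x y => hch x y t) (hD t) (hDK t) (hDn t) σ hσ
      have : IsProbabilityMeasure π := hπ.prob
      have hCt : Measurable fun p : ℝ × ℝ => D t (p.1, ξ t p.2) :=
        (hD t).comp (measurable_fst.prodMk ((hξm t).comp measurable_snd))
      calc k ≤ ∫⁻ p, C p ∂π := iInf₂_le π hπ
        _ ≤ ∫⁻ p, ((D t (p.1, ξ t p.2) + e) + (Prod.snd ⁻¹' Vᶜ).indicator (fun _ => m) p) ∂π := by
            refine lintegral_mono fun p => ?_
            obtain ⟨u, v⟩ := p
            beta_reduce
            by_cases hu : u ∈ φ '' K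
            swap
            · simp only [C]; rw [hDn t₀ u hu]; exact zero_le
            by_cases hv : v ∈ V
            swap
            · have : (Prod.snd ⁻¹' Vᶜ).indicator (fun _ => m) (u, v) = m :=
                Set.indicator_of_mem (by exact hv) _
              rw [this]
              exact (hCM _).trans le_add_self
            obtain ⟨x', hx', rfl⟩ := hu
            refine le_trans ?_ le_self_add
            simp only [C]
            rw [hDK t₀ x' hx', hDK t x' hx', he, ← ENNReal.ofReal_add (hc0 _ _ _) hη.le]
            apply ENNReal.ofReal_le_ofReal
            have := (abs_le.1 (hVc v hv t ht x' hx' x' hx' (by simpa using hr.le))).1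
            linarith
        _ = ∫⁻ p, D t (p.1, ξ t p.2) ∂π + e +
              ∫⁻ p, (Prod.snd ⁻¹' Vᶜ).indicator (fun _ => m) p ∂π := by
            rw [lintegral_add_right _ hVi, lintegral_add_right _ measurable_const,
              lintegral_const, measure_univ, mul_one]
        _ ≤ (∫⁻ p, ENNReal.ofReal (h p.1 p.2 t) ∂σ + m * e) + e + m * e := by
            gcongr
            · exact hle.trans (by gcongr)
            · exact hVint π hπ
        _ = _ := by ring
    calc _ ≤ (k + e) + e + m * e + m * e := by
          gcongr
          · exact hVint π₀ hπ₀
          · exact hSint π₀ hπ₀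
      _ ≤ (kantorovichCost (fun x y => h x y t) μ (ν t) + (e + 2 * m * e)) + e + e + m * e + m * e := by
          gcongr
      _ = _ := by ring
end loc

section glue
variable {X Y T : Type*} [TopologicalSpace X] [MeasurableSpace X] [MetricSpace Y]
  [MeasurableSpace Y] [BorelSpace Y] [MetricSpace T]
  (μ : Measure X) (ν : T → Measure Y) (φ : X → ℝ) (K : Set X) (ξ : T → ℝ → Y)
  (c h : X → Y → T → ℝ) (E : ENNReal)

lemma IsCop.convex {π₁ π₂ : Measure (ℝ × ℝ)} {a b : ℝ} (ha : 0 ≤ a) (hb : 0 ≤ b)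
    (hab : a + b = 1) (h₁ : IsCop π₁) (h₂ : IsCop π₂) :
    IsCop (ENNReal.ofReal a • π₁ + ENNReal.ofReal b • π₂) := by
  have e : ENNReal.ofReal a + ENNReal.ofReal b = 1 := by
    rw [← ENNReal.ofReal_add ha hb, hab]; simp
  constructor
  · rw [Measure.map_add _ _ measurable_fst, Measure.map_smul, Measure.map_smul, h₁.1, h₂.1,
      ← add_smul, e, one_smul]
  · rw [Measure.map_add _ _ measurable_snd, Measure.map_smul, Measure.map_smul, h₁.2, h₂.2,
      ← add_smul, e, one_smul]

lemma cdf2_convex {π₁ π₂ : Measure (ℝ × ℝ)} {a b : ℝ} (ha : 0 ≤ a) (hb : 0 ≤ b)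
    (h₁ : IsCop π₁) (h₂ : IsCop π₂) :
    cdf2 (ENNReal.ofReal a • π₁ + ENNReal.ofReal b • π₂) = a • cdf2 π₁ + b • cdf2 π₂ := by
  have := h₁.prob
  have := h₂.prob
  funext u v
  simp only [cdf2, Pi.add_apply, Pi.smul_apply, smul_eq_mul, Measure.real, Measure.coe_add,
    Measure.coe_smul]
  rw [ENNReal.toReal_add (ENNReal.mul_ne_top (by simp) (by simp))
    (ENNReal.mul_ne_top (by simp) (by simp)), ENNReal.toReal_mul, ENNReal.toReal_mul,
    ENNReal.toReal_ofReal ha, ENNReal.toReal_ofReal hb]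

lemma glue (hloc : ∀ t₀, ∃ δ > 0, ∃ π, IsCop π ∧ ∀ᶠ t in 𝓝 t₀, Good μ ν φ K ξ c h E t δ π) :
    ∃ (δ : T → ℝ) (π : T → Measure (ℝ × ℝ)), Continuous δ ∧ (∀ t, 0 < δ t) ∧ (∀ t, IsCop (π t)) ∧
      (∀ u v, Continuous fun t => cdf2 (π t) u v) ∧
      ∀ t, Good μ ν φ K ξ c h E t (δ t) (π t) := by
  obtain ⟨d, hd⟩ := exists_continuous_forall_mem_convex_of_local_const (E := ℝ)
    (t := fun t₀ => {δ : ℝ | 0 < δ ∧ ∃ π, IsCop π ∧ ∀ᶠ t in 𝓝 t₀, Good μ ν φ K ξ c h E t δ π})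
    (fun t₀ => by
      refine Set.OrdConnected.convex ⟨?_⟩
      rintro x ⟨hx, -⟩ y ⟨-, π, hπ, hy⟩ z ⟨hz1, hz2⟩
      exact ⟨hx.trans_le hz1, π, hπ, hy.mono fun t ht => ht.mono μ ν φ K ξ c h E hz2⟩)
    (fun t₀ => by
      obtain ⟨δ, hδ, π, hπ, he⟩ := hloc t₀
      refine ⟨δ, ?_⟩
      filter_upwards [he.eventually_nhds] with t ht
      exact ⟨hδ, π, hπ, ht⟩)
  obtain ⟨G, hG⟩ := exists_continuous_forall_mem_convex_of_local_const (E := ℝ → ℝ → ℝ)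
    (t := fun t => {G | ∃ π, IsCop π ∧ cdf2 π = G ∧ Good μ ν φ K ξ c h E t (d t / 2) π})
    (fun t => by
      rintro _ ⟨π₁, h1, rfl, g1⟩ _ ⟨π₂, h2, rfl, g2⟩ a b ha hb hab
      exact ⟨_, h1.convex ha hb hab h2, cdf2_convex ha hb h1 h2, g1.convex μ ν φ K ξ c h E ha hb hab g2⟩)
    (fun t₀ => by
      obtain ⟨hδ, π, hπ, he⟩ := hd t₀
      refine ⟨cdf2 π, ?_⟩
      have : ∀ᶠ t in 𝓝 t₀, d t < 2 * d t₀ :=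
        d.continuous.continuousAt.eventually_lt_const (by linarith)
      filter_upwards [he, this] with t ht ht'
      exact ⟨π, hπ, rfl, ht.mono μ ν φ K ξ c h E (by linarith)⟩)
  choose π hπ hπG hgood using hG
  refine ⟨fun t => d t / 2, π, by fun_prop, fun t => half_pos (hd t).1, hπ, fun u v => ?_, hgood⟩
  have : (fun t => cdf2 (π t) u v) = fun t => G t u v := by
    funext t; rw [hπG t]
  rw [this]
  exact (continuous_apply v).comp ((continuous_apply u).comp G.continuous)

/-- cost of the rearranged map -/
lemma cost_le {ν : Measure Y} {ξ : ℝ → Y} {c : X → Y → ℝ} 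
    (hφm : Measurable φ) (hφl : μ.map φ = lam) 
    (hξm : Measurable ξ) (hc : ∀ x, Continuous (c x))
    (M : ℝ) (hcM : ∀ x y, c x y ≤ M) {δ : ℝ} (hδ : 0 < δ) {π : Measure (ℝ × ℝ)} (hπ : IsCop π)
    {g : ℝ × ℝ → ENNReal} (hK : MeasurableSet K)
    (hb : ∀ x ∈ K, ∀ u v, |φ x - u| ≤ δ → ENNReal.ofReal (c x (ξ v)) ≤ g (u, v)) :
    ∫⁻ x, ENNReal.ofReal (c x (ξ (Sf (cdf2 π) δ (φ x)))) ∂μ ≤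
      ∫⁻ p, g p ∂π + ENNReal.ofReal M * μ Kᶜ := by
  set F : X → ENNReal := fun x => K.indicator (fun x => ENNReal.ofReal (c x (ξ (Sf (cdf2 π) δ (φ x))))) x
  have h1 : ∀ x, ENNReal.ofReal (c x (ξ (Sf (cdf2 π) δ (φ x)))) ≤
      F x + Kᶜ.indicator (fun _ => ENNReal.ofReal M) x := by
    intro x
    by_cases hx : x ∈ K
    · simp [F, hx]
    · simp only [F, Set.indicator_of_notMem hx, zero_add]
      rw [Set.indicator_of_mem (by exact hx)]
      exact ENNReal.ofReal_le_ofReal (hcM _ _)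
  refine (lintegral_mono h1).trans ?_
  rw [lintegral_add_right _ (measurable_const.indicator hK.compl),
    lintegral_indicator_const hK.compl]
  gcongr
  rw [cell_decomp μ hφm hδ, cell_decomp π measurable_fst hδ]
  refine ENNReal.tsum_le_tsum fun k => ?_
  set J := Set.Ioc ((k:ℝ) * δ) ((k+1) * δ)
  set Φ : Y → ENNReal := fun y => ⨆ (x : X) (_ : x ∈ K ∧ φ x ∈ J), ENNReal.ofReal (c x y)
  have hΦ : Measurable Φ := by
    have : LowerSemicontinuous Φ := lowerSemicontinuous_iSup fun x => lowerSemicontinuous_iSup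
      fun _ => (ENNReal.continuous_ofReal.comp (hc x)).lowerSemicontinuous
    exact this.measurable
  have hSm := Sf_measurable hπ hδ
  have hm1 : Measurable fun u => Φ (ξ (Sf (cdf2 π) δ u)) := hΦ.comp (hξm.comp hSm)
  have hm2 : Measurable fun u => Φ (ξ u) := hΦ.comp hξm
  calc ∫⁻ x in φ ⁻¹' J, F x ∂μ ≤ ∫⁻ x in φ ⁻¹' J, Φ (ξ (Sf (cdf2 π) δ (φ x))) ∂μ := by
        refine setLIntegral_mono' (hφm measurableSet_Ioc) fun x hx => ?_
        by_cases hxK : x ∈ K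
        · simp only [F, Set.indicator_of_mem hxK, Φ]
          exact le_iSup₂ (f := fun (x' : X) (_ : x' ∈ K ∧ φ x' ∈ J) =>
            ENNReal.ofReal (c x' (ξ (Sf (cdf2 π) δ (φ x))))) x ⟨hxK, hx⟩
        · simp [F, hxK]
    _ = ∫⁻ u in J, Φ (ξ (Sf (cdf2 π) δ u)) ∂lam := by
        rw [← hφl, setLIntegral_map measurableSet_Ioc hm1 hφm]
    _ = ∫⁻ v, Φ (ξ v) ∂((lam.restrict J).map (Sf (cdf2 π) δ)) := by
        rw [lintegral_map hm2 hSm]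
    _ = ∫⁻ p in J ×ˢ Set.univ, Φ (ξ p.2) ∂π := by
        rw [Sf_map_cell hπ hδ, lintegral_map hm2 measurable_snd]
    _ ≤ ∫⁻ p in J ×ˢ Set.univ, g p ∂π := by
        refine setLIntegral_mono' (measurableSet_Ioc.prod MeasurableSet.univ) fun p hp => ?_
        refine iSup₂_le fun x hx => hb x hx.1 p.1 p.2 ?_
        have a1 := hx.2
        have a2 := hp.1
        simp only [J, Set.mem_Ioc] at a1 a2
        rw [abs_le]
        constructor <;> nlinarith
    _ = _ := by
        congr 2; ext p; simp

end glue

lemma tail_bd {α : Type*} [MeasurableSpace α] {m : Measure α} {a : α → ℝ} (ham : Measurable a)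
    (h0 : ∀ x, 0 ≤ a x) (hi : Integrable a m) (R : ℝ) :
    ∫⁻ x, {x | R ≤ a x}.indicator (fun x => ENNReal.ofReal (a x)) x ∂m =
      ENNReal.ofReal (∫ x in {x | R ≤ a x}, a x ∂m) := by
  have hms : MeasurableSet {x | R ≤ a x} := measurableSet_le measurable_const ham
  rw [lintegral_indicator hms, ofReal_integral_eq_lintegral_ofReal hi.integrableOn
    (Eventually.of_forall h0)]

lemma h_split {h a b R : ℝ} (ha : 0 ≤ a) (hb : 0 ≤ b) (hd : h ≤ a + b) (hR : 0 < R) :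
    ENNReal.ofReal h ≤ ENNReal.ofReal (min h (2 * R)) + 
      ((if R ≤ a then ENNReal.ofReal a else 0) + (if R ≤ b then ENNReal.ofReal b else 0)) := by
  have e1 : (if R ≤ a then ENNReal.ofReal a else 0) = ENNReal.ofReal (if R ≤ a then a else 0) := by
    split_ifs <;> simp
  have e2 : (if R ≤ b then ENNReal.ofReal b else 0) = ENNReal.ofReal (if R ≤ b then b else 0) := by
    split_ifs <;> simp
  have p1 : 0 ≤ if R ≤ a then a else 0 := by split_ifs <;> simp [ha]
  have p2 : 0 ≤ if R ≤ b then b else 0 := by split_ifs <;> simp [hb]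
  rcases lt_or_ge h 0 with hh | hh
  · rw [ENNReal.ofReal_of_nonpos hh.le]; exact zero_le
  rw [e1, e2, ← ENNReal.ofReal_add p1 p2,
    ← ENNReal.ofReal_add (le_min hh (by linarith)) (add_nonneg p1 p2)]
  apply ENNReal.ofReal_le_ofReal
  rcases min_cases h (2 * R) with ⟨e, -⟩ | ⟨e, -⟩ <;> rw [e] <;> split_ifs <;> linarith

theorem main
    {X Y T : Type*} [TopologicalSpace X] [CompletelyRegularSpace X]
    [MetricSpace Y] [CompleteSpace Y] [MetricSpace T]
    [MeasurableSpace X] [BorelSpace X] [MeasurableSpace Y] [BorelSpace Y]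
    (μ : Measure X) (ν : T → Measure Y)
    (hμp : IsProbabilityMeasure μ) (hνp : ∀ t, IsProbabilityMeasure (ν t))
    (hna : ∀ x, μ {x} = 0) (hνr : ∀ t, (ν t).InnerRegular)
    (hμconc : ∃ K : ℕ → Set X, (∀ n, IsCompact (K n)) ∧
      (∀ n, TopologicalSpace.MetrizableSpace (K n)) ∧ μ (⋃ n, K n) = 1)
    (hνc : WeaklyContinuousFamily ν)
    (h : X → Y → T → ℝ)
    (hcont : Continuous fun p : X × Y × T => h p.1 p.2.1 p.2.2)
    (hnonneg : ∀ x y t, 0 ≤ h x y t)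
    (a : T → X → ℝ) (b : T → Y → ℝ)
    (hameas : ∀ t, Measurable (a t)) (hbmeas : ∀ t, Measurable (b t))
    (ha0 : ∀ t x, 0 ≤ a t x) (hb0 : ∀ t y, 0 ≤ b t y)
    (haint : ∀ t, Integrable (a t) μ) (hbint : ∀ t, Integrable (b t) (ν t))
    (hdom : ∀ t x y, h x y t ≤ a t x + b t y)
    (hunif : ∀ ε > (0 : ℝ), ∃ R₀ : ℝ, ∀ R ≥ R₀, ∀ t : T,
      (∫ x in {x | R ≤ a t x}, a t x ∂μ) + ∫ y in {y | R ≤ b t y}, b t y ∂(ν t) ≤ ε)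
    (ε : ℝ) (hε : 0 < ε) :
    ∃ Tm : T → X → Y,
      (∀ t, Measurable (Tm t)) ∧
      (∀ t, μ.map (Tm t) = ν t) ∧
      (∀ t, (∫⁻ x, ENNReal.ofReal (h x (Tm t x) t) ∂μ) ≤
        kantorovichCost (fun x y => h x y t) μ (ν t) + ENNReal.ofReal ε) ∧
      (∀ (t : T) (tn : ℕ → T), Tendsto tn atTop (𝓝 t) →
        ∀ᵐ x ∂μ, Tendsto (fun n => Tm (tn n) x) atTop (𝓝 (Tm t x))) := by
  obtain ⟨ξ, hξm, hξl, hξc⟩ := lemmaA ν hνp hνr hνc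
  obtain ⟨φ, hφm, hφl, hφK⟩ := lemmaB μ hna hμconc
  obtain ⟨R₀, hR₀⟩ := hunif (ε / 2) (by positivity)
  set R := max R₀ 1
  have hR : 0 < R := lt_of_lt_of_le one_pos (le_max_right _ _)
  have hRt := hR₀ R (le_max_left _ _)
  set M := 2 * R with hM
  have hM0 : 0 < M := by positivity
  set η := (ε / 2) / (3 + 5 * M) with hη
  have hη0 : 0 < η := by positivity
  obtain ⟨K, hK, hKm, hφc, hKη, hi⟩ := hφK (ENNReal.ofReal η) (by simpa using hη0)
  set c : X → Y → T → ℝ := fun x y t => min (h x y t) M with hc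
  have hcc : Continuous fun p : X × Y × T => c p.1 p.2.1 p.2.2 := hcont.min continuous_const
  have hcM : ∀ x y t, c x y t ≤ M := fun x y t => min_le_right _ _
  obtain ⟨δ, π, hδc, hδ, hπ, hπc, hgood⟩ := glue μ ν φ K ξ c h
    (3 * ENNReal.ofReal η + 4 * ENNReal.ofReal M * ENNReal.ofReal η) fun t₀ =>
    local_good μ ν φ K ξ c h hφm hφl hK hKm hφc hi hξm hξl hcc
      (fun x y t => le_min (hnonneg x y t) hM0.le) M hcM
      (fun x y t => min_le_left _ _) t₀ (hξc t₀) hη0 hKη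
  have hSm := fun t => Sf_measurable (hπ t) (hδ t)
  have hmeas : ∀ t, Measurable fun x => ξ t (Sf (cdf2 (π t)) (δ t) (φ x)) := fun t =>
    (hξm t).comp ((hSm t).comp hφm)
  have hlawS : ∀ t, μ.map (fun x => Sf (cdf2 (π t)) (δ t) (φ x)) = lam := by
    intro t
    have : (fun x => Sf (cdf2 (π t)) (δ t) (φ x)) = Sf (cdf2 (π t)) (δ t) ∘ φ := rfl
    rw [this, ← Measure.map_map (hSm t) hφm, hφl, Sf_map (hπ t) (hδ t)]
  have hlaw : ∀ t, μ.map (fun x => ξ t (Sf (cdf2 (π t)) (δ t) (φ x))) = ν t := by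
    intro t
    have hmm : Measurable fun x => Sf (cdf2 (π t)) (δ t) (φ x) := (hSm t).comp hφm
    rw [← hξl t, ← hlawS t, Measure.map_map (hξm t) hmm]
    rfl
  refine ⟨fun t x => ξ t (Sf (cdf2 (π t)) (δ t) (φ x)), hmeas, hlaw, fun t => ?_, ?_⟩
  · set Tm : X → Y := fun x => ξ t (Sf (cdf2 (π t)) (δ t) (φ x)) with hTm
    obtain ⟨g, hg, hgb, hgi⟩ := hgood t
    have hcost := cost_le μ φ K (ξ := ξ t) (c := fun x y => c x y t) (ν := ν t) hφm hφl (hξm t)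
      (fun x => hcc.comp (by fun_prop : Continuous fun y : Y => (x, y, t))) M
      (fun x y => hcM x y t) (hδ t) (hπ t) hKm hgb
    have hma : Measurable fun x =>
        {x | R ≤ a t x}.indicator (fun x => ENNReal.ofReal (a t x)) x :=
      (ENNReal.measurable_ofReal.comp (hameas t)).indicator
        (measurableSet_le measurable_const (hameas t))
    have hmb : Measurable fun y =>
        {y | R ≤ b t y}.indicator (fun y => ENNReal.ofReal (b t y)) y :=
      (ENNReal.measurable_ofReal.comp (hbmeas t)).indicator
        (measurableSet_le measurable_const (hbmeas t))
    have hmbT : Measurable fun x =>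
        {y | R ≤ b t y}.indicator (fun y => ENNReal.ofReal (b t y)) (Tm x) := hmb.comp (hmeas t)
    have htail : ∫⁻ x, {x | R ≤ a t x}.indicator (fun x => ENNReal.ofReal (a t x)) x ∂μ +
        ∫⁻ x, {y | R ≤ b t y}.indicator (fun y => ENNReal.ofReal (b t y)) (Tm x) ∂μ ≤
        ENNReal.ofReal (ε / 2) := by
      rw [← lintegral_map hmb (hmeas t), hlaw t, tail_bd (hameas t) (ha0 t) (haint t),
        tail_bd (hbmeas t) (hb0 t) (hbint t), ← ENNReal.ofReal_add]
      · exact ENNReal.ofReal_le_ofReal (hRt t)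
      · exact integral_nonneg (ha0 t)
      · exact integral_nonneg (hb0 t)
    have hE : (3 * ENNReal.ofReal η + 4 * ENNReal.ofReal M * ENNReal.ofReal η) +
        ENNReal.ofReal M * ENNReal.ofReal η = ENNReal.ofReal (ε / 2) := by
      have : ε / 2 = (3 * η + 4 * M * η) + M * η := by
        have h5 : η * (3 + 5 * M) = ε / 2 := div_mul_cancel₀ _ (by positivity)
        linarith
      rw [this, ENNReal.ofReal_add (by positivity) (by positivity),
        ENNReal.ofReal_add (by positivity) (by positivity),
        ENNReal.ofReal_mul (p := 3) (q := η) (by positivity),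
        ENNReal.ofReal_mul (p := 4 * M) (q := η) (by positivity),
        ENNReal.ofReal_mul (p := 4) (q := M) (by positivity),
        ENNReal.ofReal_mul (p := M) (q := η) (by positivity)]
      have h3 : ENNReal.ofReal 3 = 3 := by simp
      have h4 : ENNReal.ofReal 4 = 4 := by simp
      rw [h3, h4]
    calc ∫⁻ x, ENNReal.ofReal (h x (Tm x) t) ∂μ
        ≤ ∫⁻ x, (ENNReal.ofReal (c x (Tm x) t) +
          ({x | R ≤ a t x}.indicator (fun x => ENNReal.ofReal (a t x)) x +
          {y | R ≤ b t y}.indicator (fun y => ENNReal.ofReal (b t y)) (Tm x))) ∂μ := by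
          refine lintegral_mono fun x => ?_
          simp only [Set.indicator_apply, Set.mem_setOf_eq]
          have := h_split (ha0 t x) (hb0 t (Tm x)) (hdom t x (Tm x)) hR
          exact this
      _ = ∫⁻ x, ENNReal.ofReal (c x (Tm x) t) ∂μ +
          (∫⁻ x, {x | R ≤ a t x}.indicator (fun x => ENNReal.ofReal (a t x)) x ∂μ +
          ∫⁻ x, {y | R ≤ b t y}.indicator (fun y => ENNReal.ofReal (b t y)) (Tm x) ∂μ) := by
          rw [← lintegral_add_right _ hmbT]
          exact lintegral_add_right _ (hma.add hmbT)
      _ ≤ ((kantorovichCost (fun x y => h x y t) μ (ν t) +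
            (3 * ENNReal.ofReal η + 4 * ENNReal.ofReal M * ENNReal.ofReal η)) +
          ENNReal.ofReal M * ENNReal.ofReal η) + ENNReal.ofReal (ε / 2) := by
          gcongr
          refine hcost.trans ?_
          gcongr
      _ = kantorovichCost (fun x y => h x y t) μ (ν t) + ENNReal.ofReal ε := by
          rw [add_assoc (kantorovichCost _ _ _), hE, add_assoc, ← ENNReal.ofReal_add (by positivity)
            (by positivity), add_halves]
  · intro t tn htn
    have h1 : ∀ᵐ x ∂μ, ContinuousAt (fun s => Sf (cdf2 (π s)) (δ s) (φ x)) t := by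
      have := Sf_cont π hπ δ hδ hδc hπc t
      rw [← hφl] at this
      exact ae_of_ae_map hφm.aemeasurable this
    have h2 : ∀ᵐ x ∂μ, ContinuousAt (fun p : T × ℝ => ξ p.1 p.2)
        (t, Sf (cdf2 (π t)) (δ t) (φ x)) := by
      have := hξc t
      rw [← hlawS t] at this
      exact ae_of_ae_map ((hSm t).comp hφm).aemeasurable this
    filter_upwards [h1, h2] with x hx1 hx2
    have h3 : Tendsto (fun n => (tn n, Sf (cdf2 (π (tn n))) (δ (tn n)) (φ x))) atTop
        (𝓝 (t, Sf (cdf2 (π t)) (δ t) (φ x))) := htn.prodMk_nhds (hx1.tendsto.comp htn)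
    exact hx2.tendsto.comp h3

end AM

/-- **Corollary 1 of the paper.** Like Statement 3, but `X` is only assumed
completely regular and the non-atomic Radon probability measure `μ` is concentrated on a
countable union of metrizable compact sets; `Y` is a complete metric space and `t ↦ ν t`
is a weakly continuous family of Radon probability measures on `Y`. -/
theorem approx_monge_varying_target_souslin_source
    {X Y T : Type*} [TopologicalSpace X] [CompletelyRegularSpace X]
    [MetricSpace Y] [CompleteSpace Y] [MetricSpace T]
    [MeasurableSpace X] [BorelSpace X] [MeasurableSpace Y] [BorelSpace Y]
    (μ : Measure X) (ν : T → Measure Y)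
    (hμp : IsProbabilityMeasure μ) (hνp : ∀ t, IsProbabilityMeasure (ν t))
    (hμna : NoAtoms μ) (hμr : μ.InnerRegular) (hνr : ∀ t, (ν t).InnerRegular)
    (hμconc : ∃ K : ℕ → Set X, (∀ n, IsCompact (K n)) ∧
      (∀ n, TopologicalSpace.MetrizableSpace (K n)) ∧ μ (⋃ n, K n) = 1)
    (hνc : WeaklyContinuousFamily ν)
    (h : X → Y → T → ℝ)
    (hcont : Continuous fun p : X × Y × T => h p.1 p.2.1 p.2.2)
    (hnonneg : ∀ x y t, 0 ≤ h x y t)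
    (a : T → X → ℝ) (b : T → Y → ℝ)
    (hameas : ∀ t, Measurable (a t)) (hbmeas : ∀ t, Measurable (b t))
    (ha0 : ∀ t x, 0 ≤ a t x) (hb0 : ∀ t y, 0 ≤ b t y)
    (haint : ∀ t, Integrable (a t) μ) (hbint : ∀ t, Integrable (b t) (ν t))
    (hdom : ∀ t x y, h x y t ≤ a t x + b t y)
    (hunif : ∀ ε > (0 : ℝ), ∃ R₀ : ℝ, ∀ R ≥ R₀, ∀ t : T,
      (∫ x in {x | R ≤ a t x}, a t x ∂μ) + ∫ y in {y | R ≤ b t y}, b t y ∂(ν t) ≤ ε)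
    (ε : ℝ) (hε : 0 < ε) :
    ∃ Tm : T → X → Y,
      (∀ t, Measurable (Tm t)) ∧
      (∀ t, μ.map (Tm t) = ν t) ∧
      (∀ t, (∫⁻ x, ENNReal.ofReal (h x (Tm t x) t) ∂μ) ≤
        kantorovichCost (fun x y => h x y t) μ (ν t) + ENNReal.ofReal ε) ∧
      (∀ (t : T) (tn : ℕ → T), Tendsto tn atTop (𝓝 t) →
        ∀ᵐ x ∂μ, Tendsto (fun n => Tm (tn n) x) atTop (𝓝 (Tm t x))) := by
  have hna : ∀ x, μ {x} = 0 := by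
    haveI : NullSingletonClass μ := hμna
    exact fun x => measure_singleton x
  exact AM.main μ ν hμp hνp hna hνr hμconc hνc h hcont hnonneg a b hameas hbmeas ha0 hb0 haint
    hbint hdom hunif ε hε
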